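/- arXiv:1403.7659 — 14 statements merged into one kernel-verified Lean document; each statement's English description precedes it below -/
import Mathlib

section
/- Let p be a prime and (a(n))_{n≥0} a sequence of p-adic integers such that the formal power series f = ∑_{n≥0} a(n)·xⁿ ∈ ℤ_p[[x]] is algebraic over ℤ_p(x), i.e., there exists a nonzero polynomial P in two variables with coefficients in ℤ_p such that P(x, f) = 0 in ℤ_p[[x]]. Then for every α ≥ 0 the sequence n ↦ (a(n) mod p^α), with values in ℤ/p^αℤ, is p-automatic. -/
/-- A sequence with values in `A` is `k`-automatic if its `k`-kernel, the set of
sequences `n ↦ b (k^e * n + r)` for `e ≥ 0` and `0 ≤ r < k^e`, is finite. -/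
def IsKAutomatic {A : Type*} (k : ℕ) (b : ℕ → A) : Prop :=
  {g : ℕ → A | ∃ e r : ℕ, r < k ^ e ∧ g = fun n => b (k ^ e * n + r)}.Finite

open scoped PowerSeries

/-- A sequence is `k`-automatic as soon as it lies in a finite set of sequences stable under
the decimations `c ↦ (n ↦ c (k * n + r))`. -/
theorem IsKAutomatic.of_finite_stable {A : Type*} {k : ℕ} {b : ℕ → A} {S : Set (ℕ → A)}
    (hS : S.Finite) (hb : b ∈ S)
    (hstable : ∀ c ∈ S, ∀ r < k, (fun n => c (k * n + r)) ∈ S) : IsKAutomatic k b := by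
  refine hS.subset ?_
  rintro g ⟨e, r, hr, rfl⟩
  induction e generalizing r with
  | zero =>
    obtain rfl : r = 0 := by simpa using hr
    simpa using hb
  | succ e ih =>
    have hk : 0 < k ^ e := by
      rcases Nat.eq_zero_or_pos (k ^ e) with h | h
      · simp [pow_succ, h] at hr
      · exact h
    have h := hstable _ (ih (r % k ^ e) (Nat.mod_lt _ hk)) (r / k ^ e)
      (Nat.div_lt_of_lt_mul (by rwa [← pow_succ]))
    convert h using 2 with n
    conv_lhs => rw [← Nat.div_add_mod r (k ^ e)]
    ring_nf

/-- Every `k`-automatic sequence lies in a finite set of sequences stable under decimations. -/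
theorem IsKAutomatic.exists_finite_stable {A : Type*} {k : ℕ} {b : ℕ → A}
    (h : IsKAutomatic k b) : ∃ S : Set (ℕ → A), S.Finite ∧ b ∈ S ∧
      ∀ c ∈ S, ∀ r < k, (fun n => c (k * n + r)) ∈ S := by
  refine ⟨_, h, ⟨0, 0, by simp, by simp⟩, ?_⟩
  rintro _ ⟨e, s, hs, rfl⟩ r hr
  refine ⟨e + 1, k ^ e * r + s, ?_, ?_⟩
  · calc k ^ e * r + s < k ^ e * r + k ^ e := by gcongr
      _ = k ^ e * (r + 1) := by ring
      _ ≤ k ^ e * k := by gcongr; omega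
      _ = k ^ (e + 1) := by ring
  · funext n
    ring_nf

theorem IsKAutomatic.comp {A B : Type*} {k : ℕ} {b : ℕ → A} (h : IsKAutomatic k b) (D : A → B) :
    IsKAutomatic k (fun n => D (b n)) := by
  refine (h.image (fun c n => D (c n))).subset ?_
  rintro g ⟨e, r, hr, rfl⟩
  exact ⟨_, ⟨e, r, hr, rfl⟩, rfl⟩

namespace PowerSeries

section Cartier

variable {R : Type*} [CommRing R]

/-- The Cartier operator `∑ aₙ xⁿ ↦ ∑ a_{kn+r} xⁿ`. -/
noncomputable def cartier (k r : ℕ) : R⟦X⟧ →ₗ[R] R⟦X⟧ where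
  toFun f := mk fun n => coeff (k * n + r) f
  map_add' f g := by ext; simp
  map_smul' c f := by ext; simp

@[simp]
theorem coeff_cartier (k r n : ℕ) (f : R⟦X⟧) :
    coeff n (cartier k r f) = coeff (k * n + r) f := by
  simp [cartier]

theorem coeff_expand_mul_add {k : ℕ} (hk : k ≠ 0) {r : ℕ} (hr : r < k) (f g : R⟦X⟧) (n : ℕ) :
    coeff (k * n + r) (expand k hk f * g) = coeff n (f * cartier k r g) := by
  rw [coeff_mul, coeff_mul]
  have hinj : Function.Injective fun q : ℕ × ℕ => (k * q.1, k * q.2 + r) := by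
    rintro ⟨a, b⟩ ⟨c, d⟩ h
    simpa [hk] using h
  symm
  refine Finset.sum_of_injOn (fun q : ℕ × ℕ => (k * q.1, k * q.2 + r)) hinj.injOn ?_ ?_ ?_
  · rintro ⟨i, j⟩ hij
    simp only [Finset.mem_coe, Finset.HasAntidiagonal.mem_antidiagonal] at hij ⊢
    rw [← hij]
    ring
  · rintro ⟨i, j⟩ hij hnot
    rw [Finset.HasAntidiagonal.mem_antidiagonal] at hij
    rw [coeff_expand_of_not_dvd, zero_mul]
    rintro ⟨c, rfl⟩
    apply hnot
    have hcn : c ≤ n := by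
      by_contra! hlt
      have := Nat.mul_le_mul_left k (Nat.succ_le_of_lt hlt)
      rw [Nat.mul_succ] at this
      dsimp only at hij
      omega
    obtain ⟨d, rfl⟩ := Nat.exists_eq_add_of_le hcn
    refine ⟨(c, d), by simp, ?_⟩
    rw [Nat.mul_add] at hij
    dsimp only at hij ⊢
    congr 1
    omega
  · rintro ⟨i, j⟩ -
    simp [coeff_expand_mul]

theorem cartier_expand_mul {k : ℕ} (hk : k ≠ 0) {r : ℕ} (hr : r < k) (f g : R⟦X⟧) :
    cartier k r (expand k hk f * g) = f * cartier k r g := by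
  ext n
  rw [coeff_cartier, coeff_expand_mul_add hk hr]

theorem cartier_X_pow {k : ℕ} {r : ℕ} (hr : r < k) (m : ℕ) :
    cartier k r (X ^ m : R⟦X⟧) = if m % k = r then X ^ (m / k) else 0 := by
  ext n
  have h : k * n + r = m ↔ m % k = r ∧ n = m / k := by
    constructor
    · rintro rfl
      constructor
      · simp [Nat.mod_eq_of_lt hr]
      · rw [Nat.mul_add_div (by omega), Nat.div_eq_of_lt hr, add_zero]
    · rintro ⟨rfl, rfl⟩
      exact Nat.div_add_mod m k
  rw [coeff_cartier, coeff_X_pow]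
  split_ifs with h1 h2 h2
  · simp [(h.1 h1).2, coeff_X_pow]
  · exact absurd (h.1 h1).1 h2
  · rw [coeff_X_pow, if_neg fun h3 => h1 (h.2 ⟨h2, h3⟩)]
  · simp

theorem eq_sum_X_pow_mul_expand_cartier {k : ℕ} (hk : k ≠ 0) (f : R⟦X⟧) :
    f = ∑ r ∈ Finset.range k, X ^ r * expand k hk (cartier k r f) := by
  ext n
  have h : ∀ r ∈ Finset.range k, coeff n (X ^ r * expand k hk (cartier k r f)) =
      if n % k = r then coeff n f else 0 := by
    intro r hr
    rw [Finset.mem_range] at hr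
    rw [coeff_X_pow_mul']
    split_ifs with h1 h2 h2
    · subst h2
      rw [coeff_expand, if_pos (Nat.dvd_sub_mod n), coeff_cartier]
      congr 1
      rw [Nat.mul_div_cancel' (Nat.dvd_sub_mod n)]
      rw [Nat.sub_add_cancel h1]
    · apply coeff_expand_of_not_dvd
      rintro ⟨c, hc⟩
      apply h2
      obtain rfl : n = k * c + r := by omega
      simp [Nat.mod_eq_of_lt hr]
    · have := Nat.mod_le n k
      omega
    · rfl
  rw [map_sum, Finset.sum_congr rfl h]
  simp [Nat.mod_lt n (Nat.pos_of_ne_zero hk)]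

theorem exists_cartier_ne_zero {k : ℕ} (hk : k ≠ 0) {f : R⟦X⟧} (hf : f ≠ 0) :
    ∃ r < k, cartier k r f ≠ 0 := by
  by_contra! h
  apply hf
  rw [eq_sum_X_pow_mul_expand_cartier hk f]
  refine Finset.sum_eq_zero fun r hr => ?_
  rw [h r (Finset.mem_range.1 hr), map_zero, mul_zero]

theorem expand_eq_pow {p : ℕ} [Fact p.Prime] (hp : p ≠ 0) (f : (ZMod p)⟦X⟧) :
    expand p hp f = f ^ p := by
  have h := MvPowerSeries.map_frobenius_expand p hp (f := f)
  rwa [ZMod.frobenius_zmod, MvPowerSeries.map_id] at h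

end Cartier
end PowerSeries

namespace PowerSeries

section StableSubmodules

variable {R : Type*} [CommRing R]

/-- A submodule of `R⟦X⟧` stable under all the Cartier operators `cartier k r`, `r < k`. -/
def IsCartierStable (k : ℕ) (M : Submodule R R⟦X⟧) : Prop :=
  ∀ r < k, ∀ f ∈ M, cartier k r f ∈ M

theorem IsCartierStable.sup {k : ℕ} {M N : Submodule R R⟦X⟧} (hM : IsCartierStable k M)
    (hN : IsCartierStable k N) : IsCartierStable k (M ⊔ N) := by
  intro r hr f hf
  obtain ⟨a, ha, b, hb, rfl⟩ := Submodule.mem_sup.1 hf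
  rw [map_add]
  exact Submodule.add_mem_sup (hM r hr a ha) (hN r hr b hb)

theorem isCartierStable_span {k : ℕ} {S : Set R⟦X⟧}
    (hS : ∀ r < k, ∀ f ∈ S, cartier k r f ∈ Submodule.span R S) :
    IsCartierStable k (Submodule.span R S) := by
  intro r hr
  exact Submodule.span_le (p := (Submodule.span R S).comap (cartier k r)) |>.2 (hS r hr)

theorem fg_one_submodule : (1 : Submodule R R⟦X⟧).FG :=
  Submodule.one_eq_span (R := R) (A := R⟦X⟧) ▸ Submodule.fg_span_singleton 1

theorem isCartierStable_one (k : ℕ) : IsCartierStable k (1 : Submodule R R⟦X⟧) := by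
  rw [Submodule.one_eq_span]
  refine isCartierStable_span ?_
  rintro r hr _ rfl
  have := cartier_X_pow (R := R) hr 0
  rw [pow_zero, Nat.zero_div, pow_zero] at this
  rw [this]
  split_ifs
  · exact Submodule.mem_span_singleton_self _
  · exact zero_mem _

theorem isKAutomatic_coeff_of_finite {k : ℕ} {S : Set R⟦X⟧} (hS : S.Finite)
    (hstable : ∀ r < k, ∀ f ∈ S, cartier k r f ∈ S) {f : R⟦X⟧} (hf : f ∈ S) :
    IsKAutomatic k fun n => coeff n f := by
  refine IsKAutomatic.of_finite_stable (hS.image fun f n => coeff n f) ⟨f, hf, rfl⟩ ?_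
  rintro _ ⟨g, hg, rfl⟩ r hr
  exact ⟨_, hstable r hr g hg, funext fun n => coeff_cartier k r n g⟩

theorem finite_of_fg [Finite R] {M : Submodule R R⟦X⟧} (hM : M.FG) : (M : Set R⟦X⟧).Finite := by
  have : Module.Finite R M := Module.Finite.iff_fg.2 hM
  have : Finite M := Module.finite_of_finite R
  exact Set.toFinite _

theorem isKAutomatic_coeff_of_mem [Finite R] {k : ℕ} {M : Submodule R R⟦X⟧} (hM : M.FG)
    (hstable : IsCartierStable k M) {f : R⟦X⟧} (hf : f ∈ M) :
    IsKAutomatic k fun n => coeff n f :=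
  isKAutomatic_coeff_of_finite (finite_of_fg hM) hstable hf

theorem exists_fg_isCartierStable_mem {k : ℕ} {f : R⟦X⟧} (hf : IsKAutomatic k fun n => coeff n f) :
    ∃ M : Submodule R R⟦X⟧, M.FG ∧ IsCartierStable k M ∧ f ∈ M := by
  obtain ⟨S, hS, hfS, hstable⟩ := hf.exists_finite_stable
  refine ⟨Submodule.span R (mk '' S), Submodule.fg_span (hS.image _), isCartierStable_span ?_,
    Submodule.subset_span ⟨_, hfS, by ext; simp⟩⟩
  rintro r hr _ ⟨c, hc, rfl⟩
  exact Submodule.subset_span ⟨_, hstable c hc r hr, by ext; simp⟩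

theorem exists_fg_isCartierStable_subset {k : ℕ} {S : Set R⟦X⟧} (hS : S.Finite)
    (hauto : ∀ f ∈ S, IsKAutomatic k fun n => coeff n f) :
    ∃ M : Submodule R R⟦X⟧, M.FG ∧ IsCartierStable k M ∧ S ⊆ M := by
  induction S, hS using Set.Finite.induction_on with
  | empty => exact ⟨1, fg_one_submodule, isCartierStable_one k, Set.empty_subset _⟩
  | @insert f S _ _ ih =>
    obtain ⟨M, hM, hMs, hSM⟩ := ih fun g hg => hauto g (Set.mem_insert_of_mem _ hg)
    obtain ⟨N, hN, hNs, hfN⟩ := exists_fg_isCartierStable_mem (hauto f (Set.mem_insert _ _))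
    refine ⟨N ⊔ M, hN.sup hM, hNs.sup hMs, Set.insert_subset ?_ ?_⟩
    · exact Submodule.mem_sup_left hfN
    · exact hSM.trans (SetLike.coe_subset_coe.2 le_sup_right)

theorem X_pow_mem_span_one_X_pow {i n : ℕ} (h : i ≤ n) :
    (X ^ i : R⟦X⟧) ∈ Submodule.span R {1, X} ^ n := by
  have h1 : (1 : R⟦X⟧) ∈ Submodule.span R {1, (X : R⟦X⟧)} := Submodule.subset_span (by simp)
  have hX : (X : R⟦X⟧) ∈ Submodule.span R {1, (X : R⟦X⟧)} := Submodule.subset_span (by simp)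
  obtain ⟨j, rfl⟩ := Nat.exists_eq_add_of_le h
  rw [pow_add]
  simpa using Submodule.mul_mem_mul (Submodule.pow_mem_pow _ hX i) (Submodule.pow_mem_pow _ h1 j)

theorem span_one_X_pow_le (n : ℕ) :
    Submodule.span R {1, (X : R⟦X⟧)} ^ n ≤ Submodule.span R {f | ∃ i ≤ n, f = X ^ i} := by
  induction n with
  | zero =>
    rw [pow_zero, Submodule.one_eq_span, Submodule.span_le, Set.singleton_subset_iff]
    exact Submodule.subset_span ⟨0, le_rfl, by simp⟩
  | succ n ih =>
    rw [pow_succ]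
    refine (mul_le_mul' ih le_rfl).trans ?_
    rw [Submodule.span_mul_span]
    refine Submodule.span_mono ?_
    rintro _ ⟨_, ⟨i, hi, rfl⟩, g, hg, rfl⟩
    rcases hg with rfl | rfl
    · exact ⟨i, by omega, by simp⟩
    · exact ⟨i + 1, by omega, by simp [pow_succ]⟩

theorem cartier_mem_span_one_X_pow {k r : ℕ} (hr : r < k) {L : ℕ} {f : R⟦X⟧}
    (hf : f ∈ Submodule.span R {1, (X : R⟦X⟧)} ^ (k * L)) :
    cartier k r f ∈ Submodule.span R {1, (X : R⟦X⟧)} ^ L := by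
  have h : Submodule.span R {f : R⟦X⟧ | ∃ i ≤ k * L, f = X ^ i} ≤
      (Submodule.span R {1, (X : R⟦X⟧)} ^ L).comap (cartier k r) := by
    rw [Submodule.span_le]
    rintro _ ⟨i, hi, rfl⟩
    rw [SetLike.mem_coe, Submodule.mem_comap, cartier_X_pow hr]
    split_ifs
    · exact X_pow_mem_span_one_X_pow (Nat.div_le_of_le_mul hi)
    · exact zero_mem _
  exact h (span_one_X_pow_le _ hf)

/-- All powers of `⟨1, X⟩ * M` are stable under the Cartier operators if `M` is. -/
theorem IsCartierStable.span_one_X_mul_pow {k : ℕ} (hk : k ≠ 0) {M : Submodule R R⟦X⟧}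
    (hM : IsCartierStable k M) (L : ℕ) :
    IsCartierStable k ((Submodule.span R {1, X} * M) ^ L) := by
  have key : Submodule.span R {1, X} * M ≤
      Submodule.span R {1, X} ^ k * M.map (expand k hk).toLinearMap := by
    have h : ∀ ε ≤ 1, ∀ f ∈ M, X ^ ε * f ∈
        Submodule.span R {1, X} ^ k * M.map (expand k hk).toLinearMap := by
      intro ε hε f hf
      rw [eq_sum_X_pow_mul_expand_cartier hk f, Finset.mul_sum]
      refine Submodule.sum_mem _ fun r hr => ?_
      rw [Finset.mem_range] at hr
      rw [← mul_assoc, ← pow_add]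
      exact Submodule.mul_mem_mul (X_pow_mem_span_one_X_pow (by omega))
        (Submodule.mem_map_of_mem (hM r hr f hf))
    rw [Submodule.mul_le]
    intro d hd f hf
    obtain ⟨a, b, rfl⟩ := Submodule.mem_span_pair.1 hd
    rw [add_mul, smul_mul_assoc, smul_mul_assoc]
    refine add_mem (Submodule.smul_mem _ _ ?_) (Submodule.smul_mem _ _ ?_)
    · simpa using h 0 zero_le_one f hf
    · simpa using h 1 le_rfl f hf
  intro r hr
  suffices h : (Submodule.span R {1, X} * M) ^ L ≤
      ((Submodule.span R {1, X} * M) ^ L).comap (cartier k r) from fun f hf => h hf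
  calc (Submodule.span R {1, X} * M) ^ L
      ≤ (Submodule.span R {1, X} ^ k * M.map (expand k hk).toLinearMap) ^ L :=
        pow_le_pow_left' key L
    _ = Submodule.span R {1, X} ^ (k * L) * (M ^ L).map (expand k hk).toLinearMap := by
        rw [mul_pow, ← pow_mul, Submodule.map_pow]
    _ ≤ _ := by
        rw [Submodule.mul_le]
        rintro d hd _ ⟨f, hf, rfl⟩
        rw [Submodule.mem_comap, mul_pow, mul_comm d]
        have := cartier_expand_mul hk hr f d
        rw [AlgHom.toLinearMap_apply, this, mul_comm f]
        exact Submodule.mul_mem_mul (cartier_mem_span_one_X_pow hr hd) hf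

theorem le_span_one_X_mul (M : Submodule R R⟦X⟧) : M ≤ Submodule.span R {1, X} * M := by
  intro f hf
  rw [← one_mul f]
  exact Submodule.mul_mem_mul (Submodule.subset_span (by simp)) hf

theorem fg_span_one_X_mul {M : Submodule R R⟦X⟧} (hM : M.FG) :
    (Submodule.span R {1, X} * M).FG :=
  (Submodule.fg_span (by simp)).mul hM

/-- Over a finite ring, the power series with `k`-automatic coefficients form a subalgebra. -/
def automaticSubalgebra (R : Type*) [CommRing R] [Finite R] (k : ℕ) [NeZero k] :
    Subalgebra R R⟦X⟧ where
  carrier := {f | IsKAutomatic k fun n => coeff n f}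
  mul_mem' {f g} hf hg := by
    obtain ⟨M, hM, hMs, hSM⟩ := exists_fg_isCartierStable_subset (k := k) (S := {f, g})
      (Set.toFinite _) (by rintro _ (rfl | rfl) <;> assumption)
    refine isKAutomatic_coeff_of_mem ((fg_span_one_X_mul hM).pow 2)
      (hMs.span_one_X_mul_pow (NeZero.ne k) 2) ?_
    rw [pow_two]
    exact Submodule.mul_mem_mul (le_span_one_X_mul M (hSM (by simp)))
      (le_span_one_X_mul M (hSM (by simp)))
  add_mem' {f g} hf hg := by
    obtain ⟨M, hM, hMs, hSM⟩ := exists_fg_isCartierStable_subset (k := k) (S := {f, g})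
      (Set.toFinite _) (by rintro _ (rfl | rfl) <;> assumption)
    exact isKAutomatic_coeff_of_mem hM hMs (add_mem (hSM (by simp)) (hSM (by simp)))
  algebraMap_mem' c := by
    refine isKAutomatic_coeff_of_mem fg_one_submodule (isCartierStable_one k) ?_
    rw [Algebra.algebraMap_eq_smul_one]
    exact Submodule.smul_mem _ _ (Submodule.mem_one.2 ⟨1, map_one _⟩)

theorem mem_automaticSubalgebra [Finite R] {k : ℕ} [NeZero k] {f : R⟦X⟧} :
    f ∈ automaticSubalgebra R k ↔ IsKAutomatic k fun n => coeff n f :=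
  Iff.rfl

theorem X_mem_automaticSubalgebra [Finite R] {k : ℕ} [NeZero k] :
    X ∈ automaticSubalgebra R k := by
  have h := (isCartierStable_one (R := R) k).span_one_X_mul_pow (NeZero.ne k) 1
  rw [pow_one, mul_one] at h
  exact isKAutomatic_coeff_of_mem (Submodule.fg_span (by simp)) h (Submodule.subset_span (by simp))

theorem cartier_mem_automaticSubalgebra [Finite R] {k : ℕ} [NeZero k] {f : R⟦X⟧}
    (hf : f ∈ automaticSubalgebra R k) {r : ℕ} (hr : r < k) :
    cartier k r f ∈ automaticSubalgebra R k := by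
  obtain ⟨M, hM, hMs, hfM⟩ := exists_fg_isCartierStable_mem hf
  exact isKAutomatic_coeff_of_mem hM hMs (hMs r hr f hfM)

end StableSubmodules

end PowerSeries

namespace PowerSeries

section PrimeField

variable {p : ℕ} [Fact p.Prime]

theorem cartier_pow_mul {r : ℕ} (hr : r < p) (f g : (ZMod p)⟦X⟧) :
    cartier p r (f ^ p * g) = f * cartier p r g := by
  rw [← expand_eq_pow (NeZero.ne p), cartier_expand_mul _ hr]

/-- If all powers of `E` are Cartier stable, then by the pigeonhole principle the Cartier operators
decrease the exponent of large powers of `E`. -/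
theorem cartier_mem_pow_of_mem_pow_succ {E : Submodule (ZMod p) (ZMod p)⟦X⟧} (h1 : 1 ∈ E)
    (hE : ∀ L, IsCartierStable p (E ^ L)) {T : Finset (ZMod p)⟦X⟧}
    (hT : Submodule.span (ZMod p) (T : Set (ZMod p)⟦X⟧) = E) {N : ℕ} (hN : T.card * (p - 1) ≤ N)
    {r : ℕ} (hr : r < p) {f : (ZMod p)⟦X⟧} (hf : f ∈ E ^ (N + 1)) : cartier p r f ∈ E ^ N := by
  classical
  have hp : 2 ≤ p := (Fact.out : p.Prime).two_le
  have hTE : ∀ t ∈ T, t ∈ E := fun t ht => hT ▸ Submodule.subset_span ht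
  have hprod : ∀ m : Multiset (ZMod p)⟦X⟧, (∀ t ∈ m, t ∈ E) → m.prod ∈ E ^ m.card := by
    intro m
    induction m using Multiset.induction_on with
    | empty => intro; exact Submodule.one_le.1 (by simp)
    | cons a m ih =>
      intro h
      rw [Multiset.prod_cons, Multiset.card_cons, pow_succ']
      exact Submodule.mul_mem_mul (h a (Multiset.mem_cons_self a m))
        (ih fun t ht => h t (Multiset.mem_cons_of_mem ht))
  have hmono : (1 : Submodule (ZMod p) (ZMod p)⟦X⟧) ≤ E := Submodule.one_le.2 h1
  suffices h : E ^ (N + 1) ≤ (E ^ N).comap (cartier p r) from h hf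
  conv_lhs => rw [← hT, Submodule.span_pow]
  rw [Submodule.span_le]
  intro g hg
  obtain ⟨l, rfl⟩ := Set.mem_pow.1 hg
  set m : Multiset (ZMod p)⟦X⟧ := Multiset.ofList (List.ofFn fun i => (l i : (ZMod p)⟦X⟧)) with hm
  have hmT : ∀ t ∈ m, t ∈ T := by
    intro t ht
    rw [hm, Multiset.mem_coe, List.mem_ofFn] at ht
    obtain ⟨i, rfl⟩ := ht
    exact (l i).2
  have hcard : m.card = N + 1 := by simp [hm]
  obtain ⟨t, ht⟩ : ∃ t, p ≤ m.count t := by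
    by_contra! h
    have h2 : m.card ≤ T.card * (p - 1) := by
      rw [← m.toFinset_sum_count_eq, ← smul_eq_mul]
      refine (Finset.sum_le_card_nsmul _ _ (p - 1) fun t _ => ?_).trans ?_
      · have := h t
        omega
      · exact nsmul_le_nsmul_left (Nat.zero_le _)
          (Finset.card_le_card fun t ht => hmT t (Multiset.mem_toFinset.1 ht))
    omega
  obtain ⟨m', hm'⟩ := Multiset.le_iff_exists_add.1 (Multiset.le_count_iff_replicate_le.1 ht)
  have hcard' : p + m'.card = N + 1 := by rw [← hcard, hm']; simp
  have htm : t ∈ m := Multiset.count_pos.1 (by omega)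
  have hm'E : ∀ s ∈ m', s ∈ E := fun s hs => hTE s (hmT s (hm' ▸ Multiset.mem_add.2 (Or.inr hs)))
  have hgprod : (List.ofFn fun i => (l i : (ZMod p)⟦X⟧)).prod = t ^ p * m'.prod := by
    rw [← Multiset.prod_coe, ← hm, hm', Multiset.prod_add, Multiset.prod_replicate]
  rw [SetLike.mem_coe, Submodule.mem_comap, hgprod, cartier_pow_mul hr]
  have hmem := Submodule.mul_mem_mul (hTE t (hmT t htm)) (hE _ r hr _ (hprod m' hm'E))
  rw [← pow_succ'] at hmem
  exact pow_le_pow_right' hmono (by omega) hmem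

theorem exists_fg_cartier_mul_mem {S : Set (ZMod p)⟦X⟧} (hS : S.Finite)
    (hauto : ∀ f ∈ S, f ∈ automaticSubalgebra (ZMod p) p) :
    ∃ B : Submodule (ZMod p) (ZMod p)⟦X⟧, B.FG ∧ S ⊆ B ∧
      ∀ r < p, ∀ s ∈ S, ∀ b ∈ B, cartier p r (s * b) ∈ B := by
  obtain ⟨M, hM, hMs, hSM⟩ := exists_fg_isCartierStable_subset (hS.insert 1)
    (by rintro _ (rfl | hf)
        · exact one_mem (automaticSubalgebra (ZMod p) p)
        · exact hauto _ hf)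
  have hE := hMs.span_one_X_mul_pow (NeZero.ne p)
  have hME := le_span_one_X_mul M
  have hfg := fg_span_one_X_mul hM
  generalize Submodule.span (ZMod p) {1, X} * M = E at hE hME hfg
  obtain ⟨T, hT⟩ := hfg
  have h1 : 1 ∈ E := hME (hSM (Set.mem_insert _ _))
  have hSE : ∀ s ∈ S, s ∈ E := fun s hs => hME (hSM (Set.mem_insert_of_mem _ hs))
  refine ⟨E ^ (T.card * (p - 1) + 1), Submodule.FG.pow ⟨T, hT⟩ _, fun s hs => ?_,
    fun r hr s hs b hb => ?_⟩
  · have := pow_le_pow_right' (Submodule.one_le.2 h1) (show 1 ≤ T.card * (p - 1) + 1 by omega)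
    rw [pow_one] at this
    exact this (hSE s hs)
  · refine cartier_mem_pow_of_mem_pow_succ h1 hE hT (Nat.le_succ _) hr ?_
    rw [pow_succ']
    exact Submodule.mul_mem_mul (hSE s hs) hb

/-- A power series satisfying an additive (Ore) equation with automatic coefficients and nonzero
linear coefficient is automatic. -/
theorem mem_automaticSubalgebra_of_ore {g : (ZMod p)⟦X⟧} {n : ℕ} {c : ℕ → (ZMod p)⟦X⟧}
    (hc : ∀ i, c i ∈ automaticSubalgebra (ZMod p) p) (hc0 : c 0 ≠ 0)
    (hsum : ∑ i ∈ Finset.range (n + 1), c i * g ^ p ^ i = 0) :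
    g ∈ automaticSubalgebra (ZMod p) p := by
  have hp : 2 ≤ p := (Fact.out : p.Prime).two_le
  obtain ⟨B, hB, hSB, hBs⟩ := exists_fg_cartier_mul_mem (p := p)
    (S := {0, c 0, c 0 ^ (p - 1)} ∪ (fun i => c 0 ^ (p - 2) * c (i + 1)) '' (Set.Iio n))
    ((Set.toFinite _).union ((Set.finite_Iio n).image _)) (by
      rintro f ((rfl | rfl | rfl) | ⟨i, -, rfl⟩)
      · exact zero_mem _
      · exact hc 0
      · exact pow_mem (hc 0) _
      · exact mul_mem (pow_mem (hc 0) _) (hc _))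
  have hBfin := finite_of_fg hB
  let V : Set (ZMod p)⟦X⟧ := {h | ∃ b : ℕ → (ZMod p)⟦X⟧, (∀ i, b i ∈ B) ∧
    c 0 * h = ∑ i ∈ Finset.range (n + 1), b i * g ^ p ^ i}
  have hVfin : V.Finite := by
    have hfin : ((fun b : Fin (n + 1) → (ZMod p)⟦X⟧ => ∑ i, b i * g ^ p ^ (i : ℕ)) ''
        (Set.univ.pi fun _ => (B : Set (ZMod p)⟦X⟧))).Finite :=
      (Set.Finite.pi' fun _ => hBfin).image _ |>.subset (Set.image_mono fun b hb i => hb i trivial)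
    refine Set.Finite.of_finite_image (f := fun h => c 0 * h) (hfin.subset ?_)
      (mul_right_injective₀ hc0).injOn
    rintro _ ⟨h, ⟨b, hb, hbh⟩, rfl⟩
    refine ⟨fun i => b i, fun i _ => hb i, ?_⟩
    dsimp only
    rw [hbh, Finset.sum_range]
  refine isKAutomatic_coeff_of_finite hVfin ?_ (f := g) ?_
  · rintro r hr h ⟨b, hb, hbh⟩
    have hprev : ∀ i < n, cartier p r (c 0 ^ (p - 1) * b (i + 1)) -
        cartier p r (c 0 ^ (p - 2) * c (i + 1) * b 0) ∈ B := fun i hi =>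
      sub_mem (hBs r hr _ (by simp) _ (hb _)) (hBs r hr _ (Or.inr ⟨i, hi, rfl⟩) _ (hb _))
    refine ⟨fun i => if i < n then cartier p r (c 0 ^ (p - 1) * b (i + 1)) -
        cartier p r (c 0 ^ (p - 2) * c (i + 1) * b 0) else 0, fun i => ?_, ?_⟩
    · dsimp only
      split_ifs with hi
      · exact hprev i hi
      · exact zero_mem _
    · dsimp only
      rw [Finset.sum_range_succ, if_neg (lt_irrefl n), zero_mul, add_zero, ← cartier_pow_mul hr]
      have hexp : c 0 ^ p * h = ∑ i ∈ Finset.range n, (g ^ p ^ i) ^ p *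
          (c 0 ^ (p - 1) * b (i + 1) - c 0 ^ (p - 2) * c (i + 1) * b 0) := by
        have hsplit : ∑ i ∈ Finset.range n, (g ^ p ^ i) ^ p *
            (c 0 ^ (p - 1) * b (i + 1) - c 0 ^ (p - 2) * c (i + 1) * b 0) =
            c 0 ^ (p - 1) * ∑ i ∈ Finset.range n, b (i + 1) * g ^ p ^ (i + 1) -
            c 0 ^ (p - 2) * b 0 * ∑ i ∈ Finset.range n, c (i + 1) * g ^ p ^ (i + 1) := by
          rw [Finset.mul_sum, Finset.mul_sum, ← Finset.sum_sub_distrib]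
          refine Finset.sum_congr rfl fun i _ => ?_
          rw [← pow_mul, ← pow_succ]
          ring
        rw [Finset.sum_range_succ', pow_zero, pow_one] at hbh hsum
        have h1 : c 0 ^ p = c 0 ^ (p - 1) * c 0 := by
          rw [← pow_succ]
          congr 1
          omega
        have h2 : c 0 ^ (p - 1) = c 0 ^ (p - 2) * c 0 := by
          rw [← pow_succ]
          congr 1
          omega
        rw [hsplit, h1]
        linear_combination c 0 ^ (p - 1) * hbh + b 0 * g * h2 + c 0 ^ (p - 2) * b 0 * hsum
      rw [hexp, map_sum]
      refine Finset.sum_congr rfl fun i hi => ?_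
      rw [cartier_pow_mul hr, if_pos (Finset.mem_range.1 hi), map_sub, mul_comm]
  · refine ⟨fun i => if i = 0 then c 0 else 0, fun i => ?_, ?_⟩
    · dsimp only
      split_ifs
      · exact hSB (by simp)
      · exact hSB (by simp)
    · simp

end PrimeField

end PowerSeries

/-- Any sequence of powers of an algebraic element is linearly dependent. -/
theorem IsAlgebraic.not_linearIndependent_pow {A B : Type*} [CommRing A] [IsDomain A] [CommRing B]
    [IsDomain B] [Algebra A B] [FaithfulSMul A B] {g : B} (hg : IsAlgebraic A g) (e : ℕ → ℕ) :
    ¬ LinearIndependent A fun i => g ^ e i := by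
  intro hli
  let K := FractionRing A
  let L := FractionRing B
  let : Algebra K L := FractionRing.liftAlgebra A L
  have : IsScalarTower A K L := FractionRing.isScalarTower_liftAlgebra A L
  have hgK : IsIntegral K (algebraMap B L g) := ((hg.algebraMap (A := L)).extendScalars
    (IsFractionRing.injective A K)).isIntegral
  have hliK : LinearIndependent K fun i => algebraMap B L g ^ e i := by
    rw [← LinearIndependent.iff_fractionRing A K]
    have := hli.map' (IsScalarTower.toAlgHom A B L).toLinearMap
      (LinearMap.ker_eq_bot.2 (IsFractionRing.injective B L))
    simpa [Function.comp_def] using this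
  have := hgK.fg_adjoin_singleton
  have hfg : Module.Finite K (Algebra.adjoin K {algebraMap B L g}) := Module.Finite.iff_fg.2 this
  have hli' : LinearIndependent K fun i => (⟨algebraMap B L g ^ e i,
      pow_mem (Algebra.self_mem_adjoin_singleton K _) _⟩ :
      Algebra.adjoin K {algebraMap B L g}) :=
    LinearIndependent.of_comp (Algebra.adjoin K {algebraMap B L g}).val.toLinearMap hliK
  have := hli'.finite
  exact not_finite ℕ

namespace PowerSeries

section PrimeField

variable {p : ℕ} [Fact p.Prime]

/-- From an additive equation one obtains another one with nonzero linear coefficient. -/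
theorem exists_ore_coeff_zero_ne_zero {g : (ZMod p)⟦X⟧} (j : ℕ) {n : ℕ} {c : ℕ → (ZMod p)⟦X⟧}
    (hc : ∀ i, c i ∈ automaticSubalgebra (ZMod p) p) (hj : j < n) (hcj : c j ≠ 0)
    (hsum : ∑ i ∈ Finset.range n, c i * g ^ p ^ i = 0) :
    ∃ (n : ℕ) (c : ℕ → (ZMod p)⟦X⟧), (∀ i, c i ∈ automaticSubalgebra (ZMod p) p) ∧ c 0 ≠ 0 ∧
      ∑ i ∈ Finset.range (n + 1), c i * g ^ p ^ i = 0 := by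
  induction j generalizing n c with
  | zero =>
    obtain ⟨m, rfl⟩ := Nat.exists_eq_add_of_lt hj
    exact ⟨m, c, hc, hcj, by simpa using hsum⟩
  | succ j ih =>
    obtain ⟨m, rfl⟩ := Nat.exists_eq_add_of_lt (Nat.zero_lt_of_lt hj)
    rw [zero_add] at hj hsum
    by_cases h0 : c 0 = 0
    · obtain ⟨r, hr, hne⟩ := exists_cartier_ne_zero (NeZero.ne p) hcj
      refine ih (n := m) (c := fun i => cartier p r (c (i + 1)))
        (fun i => cartier_mem_automaticSubalgebra (hc _) hr) (by omega) hne ?_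
      rw [Finset.sum_range_succ', h0, zero_mul, add_zero] at hsum
      rw [← map_zero (cartier p r), ← hsum, map_sum]
      refine Finset.sum_congr rfl fun i _ => ?_
      rw [pow_succ, pow_mul, mul_comm (c (i + 1)), cartier_pow_mul hr, mul_comm]
    · exact ⟨m, c, hc, h0, hsum⟩

/-- **Christol's theorem**, with automatic coefficients: a power series over `𝔽_p` which is
algebraic over the ring of automatic power series is automatic. -/
theorem mem_automaticSubalgebra_of_isAlgebraic {g : (ZMod p)⟦X⟧}
    (hg : IsAlgebraic (automaticSubalgebra (ZMod p) p) g) :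
    g ∈ automaticSubalgebra (ZMod p) p := by
  have hdep := hg.not_linearIndependent_pow (fun i => p ^ i)
  obtain ⟨s, c, hsum, j, hj, hcj⟩ := not_linearIndependent_iff.1 hdep
  obtain ⟨n, hn⟩ := s.exists_nat_subset_range
  obtain ⟨m, d, hd, hd0, hdsum⟩ := exists_ore_coeff_zero_ne_zero (g := g) (n := n)
    (c := fun i => if i ∈ s then c i else 0) j (fun i => by
      split_ifs
      · exact (c i).2
      · exact zero_mem _) (Finset.mem_range.1 (hn hj)) (by simpa [hj] using hcj) (by
      simp only [ite_mul, zero_mul]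
      rw [← Finset.sum_filter, Finset.filter_mem_eq_inter, Finset.inter_eq_right.2 hn]
      exact hsum)
  exact mem_automaticSubalgebra_of_ore hd hd0 hdsum

end PrimeField

end PowerSeries

theorem IsKAutomatic.of_factorsThrough {A B : Type*} [Nonempty B] {k : ℕ} {b : ℕ → A} {c : ℕ → B}
    (hb : IsKAutomatic k b) (h : c.FactorsThrough b) : IsKAutomatic k c := by
  obtain ⟨D, rfl⟩ := (Function.factorsThrough_iff c).1 h
  exact hb.comp D

namespace PadicInt

variable {p : ℕ} [Fact p.Prime]

theorem toZModPow_eq_toZModPow_iff (α : ℕ) (x y : ℤ_[p]) :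
    toZModPow α x = toZModPow α y ↔ (p : ℤ_[p]) ^ α ∣ x - y := by
  rw [← sub_eq_zero, ← map_sub, ← RingHom.mem_ker, ker_toZModPow, Ideal.mem_span_singleton]

theorem toZMod_eq_toZMod_iff (x y : ℤ_[p]) : toZMod x = toZMod y ↔ (p : ℤ_[p]) ∣ x - y := by
  rw [← sub_eq_zero, ← map_sub, ← RingHom.mem_ker, ker_toZMod, maximalIdeal_eq_span_p,
    Ideal.mem_span_singleton]

theorem toZModPow_p_mul_eq_iff (α : ℕ) (x y : ℤ_[p]) :
    toZModPow (α + 1) ((p : ℤ_[p]) * x) = toZModPow (α + 1) ((p : ℤ_[p]) * y) ↔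
      toZModPow α x = toZModPow α y := by
  rw [toZModPow_eq_toZModPow_iff, toZModPow_eq_toZModPow_iff, ← mul_sub, pow_succ',
    mul_dvd_mul_iff_left prime_p.ne_zero]

end PadicInt

namespace PowerSeries

theorem coeff_natCast_mul {R : Type*} [CommRing R] (m n : ℕ) (f : R⟦X⟧) :
    coeff n ((m : R⟦X⟧) * f) = m * coeff n f := by
  rw [← nsmul_eq_mul, map_nsmul, nsmul_eq_mul]

section Padic

variable {p : ℕ} [Fact p.Prime]

theorem natCast_p_ne_zero : (p : ℤ_[p]⟦X⟧) ≠ 0 := by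
  rw [← map_natCast (C (R := ℤ_[p]))]
  exact (map_ne_zero_iff _ C_injective).2 PadicInt.prime_p.ne_zero

variable (p) in
/-- The `p`-adic power series all of whose reductions modulo powers of `p` are `p`-automatic. -/
def padicAutomaticSubalgebra : Subalgebra ℤ_[p] ℤ_[p]⟦X⟧ where
  carrier := {f | ∀ α, map (PadicInt.toZModPow α) f ∈ automaticSubalgebra (ZMod (p ^ α)) p}
  mul_mem' hf hg α := by
    rw [map_mul]
    exact mul_mem (hf α) (hg α)
  add_mem' hf hg α := by
    rw [map_add]
    exact add_mem (hf α) (hg α)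
  algebraMap_mem' c α := by
    have : map (PadicInt.toZModPow α) (algebraMap ℤ_[p] ℤ_[p]⟦X⟧ c) =
        algebraMap (ZMod (p ^ α)) (ZMod (p ^ α))⟦X⟧ (PadicInt.toZModPow α c) := by
      simp
    rw [this]
    exact algebraMap_mem _ _

theorem mem_padicAutomaticSubalgebra {f : ℤ_[p]⟦X⟧} : f ∈ padicAutomaticSubalgebra p ↔
    ∀ α, IsKAutomatic p fun n => PadicInt.toZModPow α (coeff n f) :=
  Iff.rfl

theorem X_mem_padicAutomaticSubalgebra : X ∈ padicAutomaticSubalgebra p := by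
  intro α
  rw [map_X]
  exact X_mem_automaticSubalgebra

theorem mem_padicAutomaticSubalgebra_of_p_mul {f : ℤ_[p]⟦X⟧}
    (hf : (p : ℤ_[p]⟦X⟧) * f ∈ padicAutomaticSubalgebra p) : f ∈ padicAutomaticSubalgebra p := by
  rw [mem_padicAutomaticSubalgebra] at hf ⊢
  intro α
  refine (hf (α + 1)).of_factorsThrough fun m n hmn => ?_
  dsimp only at hmn
  rwa [coeff_natCast_mul, coeff_natCast_mul, PadicInt.toZModPow_p_mul_eq_iff] at hmn

theorem map_toZMod_mem {f : ℤ_[p]⟦X⟧} (hf : f ∈ padicAutomaticSubalgebra p) :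
    map PadicInt.toZMod f ∈ automaticSubalgebra (ZMod p) p := by
  rw [mem_automaticSubalgebra]
  refine (mem_padicAutomaticSubalgebra.1 hf 1).of_factorsThrough fun m n hmn => ?_
  rw [PadicInt.toZModPow_eq_toZModPow_iff, pow_one] at hmn
  rwa [coeff_map, coeff_map, PadicInt.toZMod_eq_toZMod_iff]

theorem exists_eq_add_p_mul {f h : ℤ_[p]⟦X⟧} (hfh : map PadicInt.toZMod f = map PadicInt.toZMod h) :
    ∃ e : ℤ_[p]⟦X⟧, f = h + p * e := by
  have H : ∀ n, (p : ℤ_[p]) ∣ coeff n f - coeff n h := fun n => by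
    rw [← PadicInt.toZMod_eq_toZMod_iff, ← coeff_map, ← coeff_map, hfh]
  choose e he using H
  refine ⟨mk e, ?_⟩
  ext n
  rw [map_add, coeff_natCast_mul, coeff_mk, ← he, add_sub_cancel]

variable (p) in
/-- Reduction modulo `p` as a map between rings of automatic power series. -/
noncomputable def reduceAutomatic :
    padicAutomaticSubalgebra p →+* automaticSubalgebra (ZMod p) p :=
  ((map PadicInt.toZMod).comp (padicAutomaticSubalgebra p).val.toRingHom).codRestrict _
    fun f => map_toZMod_mem f.2

theorem p_dvd_of_reduceAutomatic_eq_zero {f : padicAutomaticSubalgebra p}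
    (hf : reduceAutomatic p f = 0) : (p : padicAutomaticSubalgebra p) ∣ f := by
  obtain ⟨e, he⟩ := exists_eq_add_p_mul (f := (f : ℤ_[p]⟦X⟧)) (h := 0)
    (by rw [map_zero]; exact congrArg Subtype.val hf)
  rw [zero_add] at he
  exact ⟨⟨e, mem_padicAutomaticSubalgebra_of_p_mul (he ▸ f.2)⟩, Subtype.ext (by simpa using he)⟩

open Polynomial in
theorem finiteMultiplicity_C_p {P : (padicAutomaticSubalgebra p)[X]} (hP : P ≠ 0) :
    FiniteMultiplicity (Polynomial.C (p : padicAutomaticSubalgebra p)) P := by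
  obtain ⟨i, hi⟩ : ∃ i, P.coeff i ≠ 0 := by
    by_contra! h
    exact hP (Polynomial.ext h)
  obtain ⟨j, hj⟩ := exists_coeff_ne_zero_iff_ne_zero.2 (Subtype.coe_injective.ne hi)
  obtain ⟨n, hn⟩ := FiniteMultiplicity.of_not_isUnit (PadicInt.p_nonunit (p := p)) hj
  refine ⟨n, fun h => hn ?_⟩
  rw [← map_pow, Polynomial.C_dvd_iff_dvd_coeff] at h
  obtain ⟨c, hc⟩ := h i
  refine ⟨coeff j (c : ℤ_[p]⟦X⟧), ?_⟩
  have hc' : ((P.coeff i : padicAutomaticSubalgebra p) : ℤ_[p]⟦X⟧) =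
      ((p ^ (n + 1) : ℕ) : ℤ_[p]⟦X⟧) * c := by
    rw [hc]
    push_cast
    rfl
  rw [hc', coeff_natCast_mul, Nat.cast_pow]

open Polynomial in
theorem isAlgebraic_map_toZMod {f : ℤ_[p]⟦X⟧} (hf : IsAlgebraic (padicAutomaticSubalgebra p) f) :
    IsAlgebraic (automaticSubalgebra (ZMod p) p) (map PadicInt.toZMod f) := by
  obtain ⟨P, hP, hPf⟩ := hf
  obtain ⟨Q, hPQ, hQ⟩ := (finiteMultiplicity_C_p hP).exists_eq_pow_mul_and_not_dvd
  refine ⟨Q.map (reduceAutomatic p), fun h0 => hQ ?_, ?_⟩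
  · rw [Polynomial.C_dvd_iff_dvd_coeff]
    intro i
    apply p_dvd_of_reduceAutomatic_eq_zero
    rw [← Polynomial.coeff_map, h0, Polynomial.coeff_zero]
  · have hQf : Polynomial.aeval f Q = 0 := by
      rw [hPQ, map_mul, map_pow, Polynomial.aeval_C] at hPf
      refine (mul_eq_zero.1 hPf).resolve_left (pow_ne_zero _ ?_)
      simpa using natCast_p_ne_zero (p := p)
    rw [← Polynomial.map_aeval_eq_aeval_map (ψ := map PadicInt.toZMod) (φ := reduceAutomatic p)
      (RingHom.ext fun _ => rfl), hQf, map_zero]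

theorem exists_lift_toZMod {g : (ZMod p)⟦X⟧} (hg : g ∈ automaticSubalgebra (ZMod p) p) :
    ∃ h ∈ padicAutomaticSubalgebra p, map PadicInt.toZMod h = g := by
  refine ⟨mk fun n => ((coeff n g).val : ℤ_[p]), ?_, ?_⟩
  · rw [mem_padicAutomaticSubalgebra]
    intro α
    simp only [coeff_mk]
    exact (mem_automaticSubalgebra.1 hg).comp fun x : ZMod p => PadicInt.toZModPow α (x.val : ℤ_[p])
  · ext n
    simp

/-- A `p`-adic power series which is algebraic over the ring of series with automatic reductions
has automatic reductions. -/
theorem mem_padicAutomaticSubalgebra_of_isAlgebraic {f : ℤ_[p]⟦X⟧}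
    (hf : IsAlgebraic (padicAutomaticSubalgebra p) f) : f ∈ padicAutomaticSubalgebra p := by
  intro α
  induction α generalizing f with
  | zero =>
    have : Subsingleton (ZMod (p ^ 0)) := by
      rw [pow_zero]
      infer_instance
    rw [Subsingleton.elim (map (PadicInt.toZModPow 0) f) 0]
    exact zero_mem _
  | succ α ih =>
    obtain ⟨h, hh, hfh⟩ := exists_lift_toZMod
      (mem_automaticSubalgebra_of_isAlgebraic (isAlgebraic_map_toZMod hf))
    obtain ⟨e, rfl⟩ := exists_eq_add_p_mul hfh.symm
    have he : IsAlgebraic (padicAutomaticSubalgebra p) e := by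
      have halg : IsAlgebraic (padicAutomaticSubalgebra p) h :=
        isAlgebraic_algebraMap (⟨h, hh⟩ : padicAutomaticSubalgebra p)
      have hp : IsAlgebraic (padicAutomaticSubalgebra p) (p : ℤ_[p]⟦X⟧) := isAlgebraic_natCast p
      refine IsAlgebraic.of_mul (mem_nonZeroDivisors_of_ne_zero natCast_p_ne_zero) hp ?_
      rw [← add_sub_cancel_left h ((p : ℤ_[p]⟦X⟧) * e)]
      exact hf.sub halg
    rw [map_add]
    refine add_mem (hh _) ?_
    rw [mem_automaticSubalgebra]
    refine IsKAutomatic.of_factorsThrough (mem_automaticSubalgebra.1 (ih he)) fun m n hmn => ?_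
    rw [coeff_map, coeff_map] at hmn ⊢
    rwa [coeff_natCast_mul, coeff_natCast_mul, PadicInt.toZModPow_p_mul_eq_iff]

end Padic

theorem transcendental_X (R : Type*) [CommRing R] : Transcendental R (X : R⟦X⟧) := by
  rw [transcendental_iff]
  intro q hq
  have h : Polynomial.aeval (X : R⟦X⟧) q = (q : R⟦X⟧) :=
    DFunLike.congr_fun (Polynomial.algHom_ext (f := Polynomial.aeval (X : R⟦X⟧))
      (g := Polynomial.coeToPowerSeries.algHom R) (by simp)) q
  rwa [h, Polynomial.coe_eq_zero_iff] at hq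

/-- A series satisfying a nontrivial polynomial equation over `R` in `X` and `f` is algebraic over
any subalgebra containing `X`. -/
theorem isAlgebraic_of_aeval_eq_zero {R : Type*} [CommRing R] [IsDomain R]
    {S : Subalgebra R R⟦X⟧} (hX : X ∈ S) {f : R⟦X⟧} {P : MvPolynomial (Fin 2) R} (hP : P ≠ 0)
    (hPf : MvPolynomial.aeval ![X, f] P = 0) : IsAlgebraic S f := by
  by_contra hf
  have hle : Algebra.adjoin R (Set.range fun _ : Unit => (X : R⟦X⟧)) ≤ S :=
    Algebra.adjoin_le (by rintro _ ⟨_, rfl⟩; exact hX)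
  have htr : Transcendental (Algebra.adjoin R (Set.range fun _ : Unit => (X : R⟦X⟧))) f :=
    fun h => hf (h.tower_top_of_subalgebra_le hle)
  have hind : AlgebraicIndependent R fun _ : Unit => (X : R⟦X⟧) :=
    (algebraicIndependent_unique_type_iff (R := R)).2 (transcendental_X R)
  have hopt := (hind.option_iff_transcendental f).2 htr
  have hinj : Function.Injective (![some (), none] : Fin 2 → Option Unit) := by decide
  have hcomp := hopt.comp _ hinj
  refine hP (algebraicIndependent_iff.1 hcomp P ?_)
  rw [← hPf]
  congr 2
  ext1 i
  fin_cases i <;> rfl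

end PowerSeries

/-- If `∑ a(n) xⁿ ∈ ℤ_p[[x]]` is algebraic over `ℤ_p(x)`, then for every `α ≥ 0`
the sequence `n ↦ a(n) mod p^α` is `p`-automatic. -/
theorem algebraic_padic_reduction_automatic (p : ℕ) [Fact p.Prime] (a : ℕ → ℤ_[p])
    (P : MvPolynomial (Fin 2) ℤ_[p]) (hP : P ≠ 0)
    (halg : MvPolynomial.aeval ![PowerSeries.X, PowerSeries.mk a] P = 0) :
    ∀ α : ℕ, IsKAutomatic p (fun n => PadicInt.toZModPow α (a n)) := by
  intro α
  have h := PowerSeries.isAlgebraic_of_aeval_eq_zero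
    PowerSeries.X_mem_padicAutomaticSubalgebra hP halg
  simpa using PowerSeries.mem_padicAutomaticSubalgebra.1
    (PowerSeries.mem_padicAutomaticSubalgebra_of_isAlgebraic h) α
end

section
/- Let k ≥ 2 be an integer and A a finite set. A sequence a : ℕ → A is k-automatic if and only if there exist a finite set B, a length-k substitution θ : B → B^k, a sequence u : ℕ → B which is a fixed point of θ, and a map τ : B → A such that a(n) = τ(u(n)) for all n ≥ 0. (Cobham's theorem: a sequence is k-automatic iff it is the image, under a letter-to-letter projection, of a fixed point of a length-k substitution.) -/
/-- The `k`-kernel of `b`. -/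
def kernelSet {A : Type*} (k : ℕ) (b : ℕ → A) : Set (ℕ → A) :=
  {g : ℕ → A | ∃ e r : ℕ, r < k ^ e ∧ g = fun n => b (k ^ e * n + r)}

theorem self_mem_kernelSet {A : Type*} (k : ℕ) (b : ℕ → A) : b ∈ kernelSet k b :=
  ⟨0, 0, by simp, by simp⟩

/-- The kernel is stable under the decimations `g ↦ (n ↦ g (k * n + i))`. -/
theorem decimation_mem_kernelSet {A : Type*} {k : ℕ} {b g : ℕ → A}
    (hg : g ∈ kernelSet k b) (i : Fin k) : (fun n => g (k * n + i)) ∈ kernelSet k b := by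
  obtain ⟨e, r, hr, rfl⟩ := hg
  refine ⟨e + 1, k ^ e * i + r, ?_, ?_⟩
  · calc k ^ e * i + r < k ^ e * (i + 1) := by rw [mul_add, mul_one]; gcongr
      _ ≤ k ^ (e + 1) := by rw [pow_succ]; exact Nat.mul_le_mul_left _ i.isLt
  · funext n
    exact congrArg b (by ring)

/-- Along a residue class modulo `k ^ e`, a fixed point of a length-`k` substitution is a
letter-to-letter image of itself. -/
theorem exists_letter_map_of_fixedPoint {B : Type*} {k : ℕ} {θ : B → Fin k → B} {u : ℕ → B}
    (hu : ∀ (n : ℕ) (i : Fin k), u (k * n + i) = θ (u n) i) (e : ℕ) :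
    ∀ r < k ^ e, ∃ f : B → B, ∀ n, u (k ^ e * n + r) = f (u n) := by
  induction e with
  | zero => exact fun r hr => ⟨id, fun n => by simp_all⟩
  | succ e ih =>
    intro r hr
    have hk : 0 < k := Nat.pos_of_ne_zero (by rintro rfl; simp at hr)
    obtain ⟨f, hf⟩ := ih (r / k) (Nat.div_lt_of_lt_mul (by rwa [← pow_succ']))
    refine ⟨fun b => θ (f b) ⟨r % k, Nat.mod_lt r hk⟩, fun n => ?_⟩
    simp only [← hf, ← hu]
    refine congrArg u ?_
    conv_lhs => rw [← Nat.div_add_mod r k]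
    ring

/-- Cobham's theorem: a sequence is `k`-automatic iff it is a letter-to-letter
projection of a fixed point of a length-`k` substitution. -/
theorem cobham_substitution_characterization {A : Type*} [Finite A]
    (k : ℕ) (hk : 2 ≤ k) (a : ℕ → A) :
    IsKAutomatic k a ↔
      ∃ (B : Type) (_ : Finite B) (θ : B → Fin k → B) (u : ℕ → B) (τ : B → A),
        (∀ (n : ℕ) (i : Fin k), u (k * n + i) = θ (u n) i) ∧
        (∀ n : ℕ, a n = τ (u n)) := by
  constructor
  · intro h
    have : Finite (kernelSet k a) := h
    obtain ⟨m, ⟨φ⟩⟩ := Finite.exists_equiv_fin (kernelSet k a → A)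
    refine ⟨Fin m, inferInstance,
      fun b i => φ fun g => φ.symm b ⟨_, decimation_mem_kernelSet g.2 i⟩,
      fun n => φ fun g => g.1 n,
      fun b => φ.symm b ⟨a, self_mem_kernelSet k a⟩, ?_, ?_⟩ <;> simp
  · rintro ⟨B, _, θ, u, τ, hu, ha⟩
    refine (Set.finite_range fun (f : B → B) (n : ℕ) => τ (f (u n))).subset ?_
    rintro _ ⟨e, r, hr, rfl⟩
    obtain ⟨f, hf⟩ := exists_letter_map_of_fixedPoint hu e r hr
    exact ⟨f, by simp [ha, hf]⟩
end

section
/- Let p be a prime and a : ℕ → ℤ_p a sequence such that for every α ≥ 0 the reduction a_α : ℕ → ℤ/p^αℤ (given by a_α(n) = a(n) mod p^α) is p-automatic. Then there exist, for every α ≥ 0: a finite set S_α, a length-p substitution θ_α : S_α → S_α^p, a sequence u_α : ℕ → S_α which is a fixed point of θ_α, a map τ_α : S_α → ℤ/p^αℤ, and a surjection π_α : S_{α+1} → S_α, such that: (i) τ_α(u_α(n)) = a(n) mod p^α for all n ≥ 0; (ii) π_α(u_{α+1}(n)) = u_α(n) for all n ≥ 0; (iii) π_α(θ_{α+1}(s)_i)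 = θ_α(π_α(s))_i for all s ∈ S_{α+1} and 0 ≤ i < p; and (iv) τ_α(π_α(s)) = τ_{α+1}(s) mod p^α for all s ∈ S_{α+1}. (Compatibility of the substitutions and codings at all levels, making their inverse limit well defined.) -/
/-- Two natural numbers are equivalent when no member of the `k`-kernel of `b` separates them. -/
def kernelSetoid {A : Type*} (k : ℕ) (b : ℕ → A) : Setoid ℕ where
  r m n := ∀ e r : ℕ, r < k ^ e → b (k ^ e * m + r) = b (k ^ e * n + r)
  iseqv :=
    ⟨fun _ _ _ _ => rfl, fun h e r hr => (h e r hr).symm,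
      fun h₁ h₂ e r hr => (h₁ e r hr).trans (h₂ e r hr)⟩

theorem IsKAutomatic.finite_quotient {A : Type*} [Finite A] {k : ℕ} {b : ℕ → A}
    (h : IsKAutomatic k b) : Finite (Quotient (kernelSetoid k b)) := by
  let K := {g : ℕ → A | ∃ e r : ℕ, r < k ^ e ∧ g = fun n => b (k ^ e * n + r)}
  have : Finite K := h.to_subtype
  let f : Quotient (kernelSetoid k b) → K → A :=
    Quotient.lift (fun n g => g.1 n) (by
      rintro m n hmn
      funext ⟨g, e, r, hr, hg⟩
      subst hg
      exact hmn e r hr)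
  refine Finite.of_injective f fun x y => ?_
  induction x, y using Quotient.inductionOn₂ with
  | _ m n =>
    intro hxy
    exact Quotient.sound fun e r hr =>
      congrFun hxy ⟨fun n => b (k ^ e * n + r), e, r, hr, rfl⟩

theorem kernelSetoid_mul_add {A : Type*} {k : ℕ} {b : ℕ → A} {m n : ℕ}
    (h : kernelSetoid k b m n) (i : Fin k) :
    kernelSetoid k b (k * m + i) (k * n + i) := by
  intro e r hr
  have hlt : k ^ e * i + r < k ^ (e + 1) :=
    calc k ^ e * i + r < k ^ e * (i + 1) := by rw [mul_add, mul_one]; gcongr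
      _ ≤ k ^ (e + 1) := by rw [pow_succ]; exact Nat.mul_le_mul_left _ i.isLt
  have key := h (e + 1) (k ^ e * i + r) hlt
  convert key using 2 <;> ring

theorem kernelSetoid_apply_eq {A : Type*} {k : ℕ} {b : ℕ → A} {m n : ℕ}
    (h : kernelSetoid k b m n) : b m = b n := by
  simpa using h 0 0 (by simp)

theorem kernelSetoid_comp {A B : Type*} {k : ℕ} {b : ℕ → A} {c : ℕ → B} (f : A → B)
    (hf : ∀ n, f (b n) = c n) {m n : ℕ} (h : kernelSetoid k b m n) :
    kernelSetoid k c m n := by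
  intro e r hr
  rw [← hf, ← hf, h e r hr]

/-- If `a : ℕ → ℤ_p` reduces to a `p`-automatic sequence modulo every `p^α`, then there
are, for every `α`, a finite alphabet `S α`, a length-`p` substitution `θ α` with fixed
point `u α`, a coding `τ α` producing `a mod p^α`, and surjections `π α : S (α+1) → S α`
compatible with the substitutions, the fixed points, and the codings. -/
theorem compatible_substitution_tower (p : ℕ) [Fact p.Prime] (a : ℕ → ℤ_[p])
    (h : ∀ α : ℕ, IsKAutomatic p fun n => PadicInt.toZModPow α (a n)) :
    ∃ (S : ℕ → Type) (_ : ∀ α, Finite (S α))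
      (θ : ∀ α, S α → Fin p → S α) (u : ∀ α, ℕ → S α)
      (τ : ∀ α, S α → ZMod (p ^ α)) (π : ∀ α, S (α + 1) → S α),
      (∀ α, Function.Surjective (π α)) ∧
      (∀ (α n : ℕ) (i : Fin p), u α (p * n + i) = θ α (u α n) i) ∧
      (∀ α n : ℕ, τ α (u α n) = PadicInt.toZModPow α (a n)) ∧
      (∀ α n : ℕ, π α (u (α + 1) n) = u α n) ∧
      (∀ (α : ℕ) (s : S (α + 1)) (i : Fin p), π α (θ (α + 1) s i) = θ α (π α s) i) ∧
      (∀ (α : ℕ) (s : S (α + 1)),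
        τ α (π α s) =
          ZMod.castHom (pow_dvd_pow p (Nat.le_succ α)) (ZMod (p ^ α)) (τ (α + 1) s)) := by
  have hcast : ∀ α n : ℕ, ZMod.castHom (pow_dvd_pow p (Nat.le_succ α)) (ZMod (p ^ α))
      (PadicInt.toZModPow (α + 1) (a n)) = PadicInt.toZModPow α (a n) := fun α n =>
    congrArg (fun φ : ℤ_[p] →+* ZMod (p ^ α) => φ (a n))
      (PadicInt.zmod_cast_comp_toZModPow α (α + 1) (Nat.le_succ α))
  let R : ∀ α : ℕ, Setoid ℕ := fun α => kernelSetoid p fun n => PadicInt.toZModPow α (a n)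
  refine ⟨fun α => Quotient (R α), fun α => (h α).finite_quotient,
    fun α s i => Quotient.map (fun n => p * n + i)
      (fun _ _ hmn => kernelSetoid_mul_add hmn i) s,
    fun α n => Quotient.mk (R α) n,
    fun α => Quotient.lift (fun n => PadicInt.toZModPow α (a n))
      (fun _ _ hmn => kernelSetoid_apply_eq
        (b := fun n => PadicInt.toZModPow α (a n)) hmn),
    fun α => Quotient.map id (fun _ _ hmn => kernelSetoid_comp _ (hcast α) hmn),
    ?_, fun _ _ _ => rfl, fun _ _ => rfl, fun _ _ => rfl, ?_, ?_⟩
  · intro α s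
    induction s using Quotient.inductionOn with
    | _ n => exact ⟨Quotient.mk _ n, rfl⟩
  · intro α s i
    induction s using Quotient.inductionOn with
    | _ n => rfl
  · intro α s
    induction s using Quotient.inductionOn with
    | _ n => exact (hcast α n).symm
end

section
/- Let p be a prime and a : ℕ → ℤ_p a sequence. Suppose that for every α ≥ 0 the shift on X_{a_α} ⊆ (ℤ/p^αℤ)^ℕ is minimal, i.e., every point of the closure X_{a_α} of the shift orbit of a_α has dense forward shift orbit in X_{a_α}. Then the shift on X_a ⊆ ℤ_p^ℕ is minimal: every point of the closure X_a of the shift orbit of a has dense forward shift orbit in X_a. -/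
/-- The shift map on one-sided sequences. -/
def shift {A : Type*} (x : ℕ → A) : ℕ → A := fun n => x (n + 1)

/-- The shift-orbit closure of a sequence. -/
def orbitClosure {A : Type*} [TopologicalSpace A] (b : ℕ → A) : Set (ℕ → A) :=
  closure {y : ℕ → A | ∃ n : ℕ, y = shift^[n] b}

/-- Congruence modulo `p ^ n` is the norm condition `‖z - w‖ ≤ p ^ (-n)`. -/
theorem toZModPow_eq_iff_norm_sub_le {p : ℕ} [Fact p.Prime] (n : ℕ) (z w : ℤ_[p]) :
    PadicInt.toZModPow n z = PadicInt.toZModPow n w ↔ ‖z - w‖ ≤ (p : ℝ) ^ (-n : ℤ) := by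
  rw [PadicInt.norm_le_pow_iff_mem_span_pow, ← PadicInt.ker_toZModPow, RingHom.mem_ker, map_sub,
    sub_eq_zero]

theorem continuous_toZModPow {p : ℕ} [Fact p.Prime] (n : ℕ) :
    Continuous (PadicInt.toZModPow n : ℤ_[p] → ZMod (p ^ n)) := by
  have hp : (0 : ℝ) < p := by exact_mod_cast (Fact.out : p.Prime).pos
  refine (IsLocallyConstant.iff_eventually_eq _).2 (fun z => ?_) |>.continuous
  filter_upwards [Metric.ball_mem_nhds z (zpow_pos hp (-n : ℤ))] with w hw
  rw [toZModPow_eq_iff_norm_sub_le, ← dist_eq_norm]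
  exact (Metric.mem_ball.1 hw).le

/-- A sequence of `p`-adic integers lies in the closure of `S` as soon as all its reductions
lie in the closures of the reductions of `S`. -/
theorem mem_closure_of_forall_toZModPow {p : ℕ} [Fact p.Prime] {S : Set (ℕ → ℤ_[p])}
    {y : ℕ → ℤ_[p]}
    (h : ∀ α : ℕ, (fun n => PadicInt.toZModPow α (y n)) ∈
      closure ((fun (z : ℕ → ℤ_[p]) n => PadicInt.toZModPow α (z n)) '' S)) :
    y ∈ closure S := by
  have approx : ∀ k : ℕ, ∃ s ∈ S, ∀ i < k,
      PadicInt.toZModPow k (s i) = PadicInt.toZModPow k (y i) := by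
    intro k
    have ho : IsOpen (Set.pi (Set.Iio k) fun i => {PadicInt.toZModPow k (y i)}) :=
      isOpen_set_pi (Set.finite_Iio k) fun _ _ => isOpen_discrete _
    obtain ⟨_, hs, s, hsS, rfl⟩ := mem_closure_iff.1 (h k) _ ho fun i _ => rfl
    exact ⟨s, hsS, hs⟩
  choose s hsS hs using approx
  have hp : (1 : ℝ) < p := by exact_mod_cast (Fact.out : p.Prime).one_lt
  refine mem_closure_of_tendsto (f := s) (b := Filter.atTop) (tendsto_pi_nhds.2 fun i => ?_)
    (Filter.Eventually.of_forall hsS)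
  refine tendsto_iff_norm_sub_tendsto_zero.2 ?_
  refine squeeze_zero' (Filter.Eventually.of_forall fun _ => norm_nonneg _) ?_
    (tendsto_pow_atTop_nhds_zero_of_lt_one (inv_nonneg.2 (zero_le_one.trans hp.le))
      (inv_lt_one_of_one_lt₀ hp))
  filter_upwards [Filter.eventually_gt_atTop i] with k hk
  simpa using (toZModPow_eq_iff_norm_sub_le k _ _).1 (hs k i hk)

theorem shift_iterate_comp {A B : Type*} (f : A → B) (x : ℕ → A) (n : ℕ) :
    shift^[n] (fun i => f (x i)) = fun i => f (shift^[n] x i) := by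
  induction n generalizing x with
  | zero => rfl
  | succ n ih => exact ih (shift x)

theorem image_shift_orbit {A B : Type*} (f : A → B) (x : ℕ → A) :
    (fun (z : ℕ → A) i => f (z i)) '' {y | ∃ n : ℕ, y = shift^[n] x} =
      {y | ∃ n : ℕ, y = shift^[n] fun i => f (x i)} := by
  ext y
  constructor
  · rintro ⟨_, ⟨n, rfl⟩, rfl⟩
    exact ⟨n, (shift_iterate_comp f x n).symm⟩
  · rintro ⟨n, rfl⟩
    exact ⟨_, ⟨n, rfl⟩, (shift_iterate_comp f x n).symm⟩

theorem comp_mem_orbitClosure {A B : Type*} [TopologicalSpace A] [TopologicalSpace B]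
    {f : A → B} (hf : Continuous f) {b x : ℕ → A} (hx : x ∈ orbitClosure b) :
    (fun i => f (x i)) ∈ orbitClosure fun i => f (b i) := by
  have hc : Continuous fun (z : ℕ → A) i => f (z i) :=
    continuous_pi fun i => hf.comp (continuous_apply i)
  rw [orbitClosure, ← image_shift_orbit]
  exact image_closure_subset_closure_image hc ⟨x, hx, rfl⟩

/-- If for every `α ≥ 0` the shift on the orbit closure of the reduction `a mod p^α` is
minimal (every point has dense forward orbit), then the shift on the orbit closure of
`a : ℕ → ℤ_p` is minimal. -/
theorem minimal_of_levelwise_minimal (p : ℕ) [Fact p.Prime] (a : ℕ → ℤ_[p])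
    (h : ∀ α : ℕ, ∀ x ∈ orbitClosure fun n => PadicInt.toZModPow α (a n),
      (orbitClosure fun n => PadicInt.toZModPow α (a n)) ⊆
        closure {y : ℕ → ZMod (p ^ α) | ∃ n : ℕ, y = shift^[n] x}) :
    ∀ x ∈ orbitClosure a,
      orbitClosure a ⊆ closure {y : ℕ → ℤ_[p] | ∃ n : ℕ, y = shift^[n] x} := by
  intro x hx y hy
  refine mem_closure_of_forall_toZModPow fun α => ?_
  rw [image_shift_orbit]
  exact h α _ (comp_mem_orbitClosure (continuous_toZModPow α) hx)
    (comp_mem_orbitClosure (continuous_toZModPow α) hy)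
end

section
/- Let (X_n)_{n≥0} be a sequence of compact metric spaces, π_n : X_{n+1} → X_n continuous maps, and μ_n a Borel probability measure on X_n for each n, such that the pushforward of μ_{n+1} under π_n equals μ_n for every n. Let L = {x ∈ ∏_{n≥0} X_n : π_n(x_{n+1}) = x_n for all n} be the inverse limit, with the subspace topology from the product topology. Then there exists a Borel probability measure μ on L such that for every n the pushforward of μ under the coordinate projection L → X_n equals μ_n. -/
open MeasureTheory

section InverseLimit

variable {X : ℕ → Type*} [∀ n, MeasurableSpace (X n)] {π : ∀ n, X (n + 1) → X n}

/-- Every point of `X k` extends, measurably, to a point of the product that is compatible with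
the bonding maps below `k`. -/
theorem exists_measurable_partial_thread [∀ n, Nonempty (X n)] (hπ : ∀ n, Measurable (π n))
    (k : ℕ) : ∃ s : X k → ∀ n, X n, Measurable s ∧ (∀ x, s x k = x) ∧
      ∀ n < k, ∀ x, π n (s x (n + 1)) = s x n := by
  induction k with
  | zero =>
    refine ⟨fun x => Function.update (fun n => Classical.arbitrary (X n)) 0 x,
      measurable_update _, by simp, by simp⟩
  | succ k ih =>
    obtain ⟨s, hs, hsk, hsπ⟩ := ih
    refine ⟨fun x => Function.update (s (π k x)) (k + 1) x, ?_, by simp, fun n hn x => ?_⟩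
    · exact measurable_update'.comp ((hs.comp (hπ k)).prodMk measurable_id)
    · dsimp only
      rcases Nat.lt_succ_iff_lt_or_eq.mp hn with h | rfl
      · rw [Function.update_of_ne (by omega), Function.update_of_ne (by omega), hsπ n h]
      · rw [Function.update_self, Function.update_of_ne (by omega), hsk]

/-- There is a probability measure on the product whose joint laws on consecutive coordinates
below `k` are those prescribed by the inverse system. -/
theorem exists_measure_map_consecutive_eq (hπ : ∀ n, Measurable (π n))
    {μ : ∀ n, Measure (X n)} [∀ n, IsProbabilityMeasure (μ n)]
    (hcompat : ∀ n, (μ (n + 1)).map (π n) = μ n) (k : ℕ) :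
    ∃ ν : Measure (∀ n, X n), IsProbabilityMeasure ν ∧ ∀ n < k,
      ν.map (fun x => (x n, x (n + 1))) = (μ (n + 1)).map (fun y => (π n y, y)) := by
  have (n : ℕ) : Nonempty (X n) := nonempty_of_isProbabilityMeasure (μ n)
  obtain ⟨s, hs, hsk, hsπ⟩ := exists_measurable_partial_thread hπ k
  have hmarg : ∀ n ≤ k, (μ k).map (fun x => s x n) = μ n := by
    intro n hn
    induction hn using Nat.decreasingInduction with
    | self => simp [hsk]
    | of_succ n hn ih =>
      rw [← hcompat n, ← ih, Measure.map_map (hπ n) (by fun_prop)]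
      simp [Function.comp_def, hsπ n hn]
  refine ⟨(μ k).map s, Measure.isProbabilityMeasure_map hs.aemeasurable, fun n hn => ?_⟩
  have := hπ n
  rw [← hmarg (n + 1) hn, Measure.map_map (by fun_prop) hs,
    Measure.map_map (by fun_prop) (by fun_prop)]
  simp [Function.comp_def, hsπ n hn]

end InverseLimit

/-- Choksi: the inverse limit of an inverse family of compact metric spaces equipped
with compatible Borel probability measures carries a Borel probability measure that
pushes forward to each of the given measures under the coordinate projections. -/
theorem exists_inverse_limit_measure
    (X : ℕ → Type*) [∀ n, MetricSpace (X n)] [∀ n, CompactSpace (X n)]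
    [∀ n, MeasurableSpace (X n)] [∀ n, BorelSpace (X n)]
    (π : ∀ n, X (n + 1) → X n) (hπ : ∀ n, Continuous (π n))
    (μ : ∀ n, Measure (X n)) (hprob : ∀ n, IsProbabilityMeasure (μ n))
    (hcompat : ∀ n, (μ (n + 1)).map (π n) = μ n) :
    ∃ ν : Measure {x : ∀ n, X n // ∀ n, π n (x (n + 1)) = x n},
      IsProbabilityMeasure ν ∧ ∀ n, ν.map (fun x => x.1 n) = μ n := by
  have hπm (n : ℕ) : Measurable (π n) := (hπ n).measurable
  have hpair (n : ℕ) : Continuous fun x : ∀ n, X n => (x n, x (n + 1)) := by fun_prop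
  have hgraph (n : ℕ) : Measurable fun y => (π n y, y) := (hπm n).prodMk measurable_id
  let C (n : ℕ) : Set (ProbabilityMeasure (∀ n, X n)) :=
    {ν | ν.map (hpair n).aemeasurable =
      ProbabilityMeasure.map ⟨μ (n + 1), hprob (n + 1)⟩ (hgraph n).aemeasurable}
  have hC (n : ℕ) : IsClosed (C n) :=
    isClosed_eq (ProbabilityMeasure.continuous_map (hpair n)) continuous_const
  have hCne (k : ℕ) : (⋂ n < k, C n).Nonempty := by
    obtain ⟨ν, hν, h⟩ := exists_measure_map_consecutive_eq hπm hcompat k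
    exact ⟨⟨ν, hν⟩, Set.mem_iInter₂.2 fun n hn => Subtype.ext (h n hn)⟩
  have hcl (k : ℕ) : IsClosed (⋂ n < k, C n) := isClosed_biInter fun n _ => hC n
  obtain ⟨ν, hν⟩ := IsCompact.nonempty_iInter_of_sequence_nonempty_isCompact_isClosed
    (fun k => ⋂ n < k, C n)
    (fun k => Set.biInter_subset_biInter_left fun n hn => Nat.lt_succ_of_lt hn)
    hCne (hcl 0).isCompact hcl
  have hjoint (n : ℕ) : (ν : Measure (∀ n, X n)).map (fun x => (x n, x (n + 1))) =
      (μ (n + 1)).map (fun y => (π n y, y)) :=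
    congrArg Subtype.val (Set.mem_iInter₂.1 (Set.mem_iInter.1 hν (n + 1)) n n.lt_succ_self)
  have hmarg (n : ℕ) : (ν : Measure (∀ n, X n)).map (fun x => x n) = μ n := by
    have h := congrArg (Measure.map Prod.fst) (hjoint n)
    rw [Measure.map_map measurable_fst (hpair n).measurable,
      Measure.map_map measurable_fst (hgraph n)] at h
    exact h.trans (hcompat n)
  have hthread : ∀ᵐ x ∂(ν : Measure (∀ n, X n)), ∀ n, π n (x (n + 1)) = x n := by
    refine ae_all_iff.2 fun n => ?_
    have hD : MeasurableSet {p : X n × X (n + 1) | π n p.2 = p.1} :=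
      (isClosed_eq ((hπ n).comp continuous_snd) continuous_fst).measurableSet
    refine (ae_map_iff (hpair n).aemeasurable hD).1 ?_
    rw [hjoint n, ae_map_iff (hgraph n).aemeasurable hD]
    simp
  have hL : MeasurableSet {x : ∀ n, X n | ∀ n, π n (x (n + 1)) = x n} := by
    rw [Set.ofPred_forall]
    exact MeasurableSet.iInter fun n => measurableSet_eq_fun (by fun_prop) (by fun_prop)
  have hmap : ((ν : Measure (∀ n, X n)).comap Subtype.val).map
      (Subtype.val : {x : ∀ n, X n // ∀ n, π n (x (n + 1)) = x n} → ∀ n, X n) = ν :=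
    (map_comap_subtype_coe hL _).trans (Measure.restrict_eq_self_of_ae_mem hthread)
  refine ⟨(ν : Measure (∀ n, X n)).comap Subtype.val, ?_, fun n => ?_⟩
  · exact (Measure.isProbabilityMeasure_map_iff measurable_subtype_coe.aemeasurable).1
      (by rw [hmap]; infer_instance)
  · rw [← hmarg n, ← hmap, Measure.map_map (measurable_pi_apply n) measurable_subtype_coe, hmap]
    rfl
end

section
/- Let p be a prime and let C(n) = (1/(n+1))·binomial(2n, n) denote the n-th Catalan number. Then for every k ∈ ℕ and r ∈ ℕ, the sequence n ↦ C(k·pⁿ + r), viewed as a sequence of p-adic integers, converges in ℤ_p. -/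
open Filter

open Polynomial in
/-- Passing from `A * p ^ n` choose `k * p ^ n` to the next exponent changes the binomial
coefficient by a multiple of `p ^ (n + 1)`. -/
theorem pow_succ_dvd_choose_mul_pow_sub (p : ℕ) (hp : p.Prime) (A k n : ℕ) :
    (p : ℤ) ^ (n + 1) ∣
      ((A * p ^ (n + 1)).choose (k * p ^ (n + 1)) : ℤ) - (A * p ^ n).choose (k * p ^ n) := by
  have h_base : ((p : ℕ) : ℤ[X]) ∣ (1 + X) ^ p - (1 + X ^ p) := by
    obtain ⟨r, hr⟩ := exists_add_pow_prime_eq hp (1 : ℤ[X]) X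
    refine ⟨X * r, ?_⟩
    rw [hr]
    ring
  have h_pow := (dvd_sub_pow_of_dvd_sub h_base n).trans
    (sub_dvd_pow_sub_pow (((1 + X : ℤ[X]) ^ p) ^ p ^ n) ((1 + X ^ p) ^ p ^ n) A)
  have h_const : ((p : ℕ) : ℤ[X]) ^ (n + 1) = C ((p : ℤ) ^ (n + 1)) := by simp
  have h_left : (((1 + X : ℤ[X]) ^ p) ^ p ^ n) ^ A = (1 + X) ^ (A * p ^ (n + 1)) := by
    rw [← pow_mul, ← pow_mul]
    congr 1
    ring
  have h_right : ((1 + X ^ p : ℤ[X]) ^ p ^ n) ^ A = expand ℤ p ((1 + X) ^ (A * p ^ n)) := by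
    rw [← pow_mul, mul_comm A]
    simp
  rw [h_const, h_left, h_right, C_dvd_iff_dvd_coeff] at h_pow
  have h_coeff := h_pow (k * p ^ n * p)
  rw [coeff_sub, coeff_expand_mul hp.pos, coeff_one_add_X_pow, coeff_one_add_X_pow,
    mul_assoc k, ← pow_succ] at h_coeff
  exact h_coeff

theorem tendsto_natCast_pow_padicInt (p : ℕ) [Fact p.Prime] :
    Tendsto (fun n : ℕ => (p : ℤ_[p]) ^ n) atTop (nhds 0) :=
  tendsto_pow_atTop_nhds_zero_of_norm_lt_one (PadicInt.norm_lt_one_iff_dvd _ |>.mpr dvd_rfl)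

/-- A sequence in `ℤ_[p]` times a null sequence is a null sequence. -/
theorem PadicInt.tendsto_mul_zero {p : ℕ} [Fact p.Prime] (f : ℕ → ℤ_[p]) {g : ℕ → ℤ_[p]}
    (hg : Tendsto g atTop (nhds 0)) : Tendsto (fun n => f n * g n) atTop (nhds 0) := by
  refine squeeze_zero_norm (fun n => ?_) (tendsto_zero_iff_norm_tendsto_zero.mp hg)
  rw [norm_mul]
  exact mul_le_of_le_one_left (norm_nonneg _) (PadicInt.norm_le_one _)

theorem exists_tendsto_choose_mul_pow (p : ℕ) [hp : Fact p.Prime] (A k : ℕ) :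
    ∃ L : ℤ_[p],
      Tendsto (fun n : ℕ => ((A * p ^ n).choose (k * p ^ n) : ℤ_[p])) atTop (nhds L) := by
  refine cauchySeq_tendsto_of_complete
    (NonarchimedeanAddGroup.cauchySeq_of_tendsto_sub_nhds_zero ?_)
  choose c hc using pow_succ_dvd_choose_mul_pow_sub p hp.out A k
  have h := PadicInt.tendsto_mul_zero (fun n => (c n : ℤ_[p]))
    ((tendsto_natCast_pow_padicInt p).comp (tendsto_add_atTop_nat 1))
  refine h.congr fun n => ?_
  have := congrArg (Int.cast : ℤ → ℤ_[p]) (hc n)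
  push_cast at this
  rw [this, mul_comm]
  rfl

theorem eventually_pos_mul_pow_add {p k : ℕ} (hp : 1 < p) (hk : 0 < k) (t : ℤ) :
    ∀ᶠ n : ℕ in atTop, 0 < (k : ℤ) * p ^ n + t := by
  filter_upwards [eventually_ge_atTop t.natAbs] with n hn
  have h_lt : n < p ^ n := Nat.lt_pow_self hp
  have h_le : p ^ n ≤ k * p ^ n := Nat.le_mul_of_pos_left _ hk
  have : ((p ^ n : ℕ) : ℤ) ≤ (k * p ^ n : ℕ) := by exact_mod_cast h_le
  push_cast at this
  zify at h_lt
  omega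

theorem tendsto_choose_mul_pow_add_zero (p : ℕ) [hp : Fact p.Prime] (A : ℕ) {k : ℕ} (hk : 0 < k)
    {t : ℤ} (ht : t ≠ 0) :
    Tendsto (fun n : ℕ => ((A * p ^ n).choose ((k : ℤ) * p ^ n + t).toNat : ℤ_[p]))
      atTop (nhds 0) := by
  rcases Nat.eq_zero_or_pos A with rfl | hA
  · refine tendsto_const_nhds.congr' ?_
    filter_upwards [eventually_pos_mul_pow_add hp.out.one_lt hk t] with n hn
    rw [zero_mul, Nat.choose_eq_zero_of_lt (by omega), Nat.cast_zero]
  have h_mul : Tendsto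
      (fun n : ℕ => ((A * p ^ n).choose ((k : ℤ) * p ^ n + t).toNat : ℤ_[p]) * t)
      atTop (nhds 0) := by
    have h := PadicInt.tendsto_mul_zero (p := p) (fun n : ℕ =>
      (A : ℤ_[p]) * ((A * p ^ n - 1).choose (((k : ℤ) * p ^ n + t).toNat - 1) : ℤ_[p])
        - ((A * p ^ n).choose ((k : ℤ) * p ^ n + t).toNat : ℤ_[p]) * k)
      (tendsto_natCast_pow_padicInt p)
    refine h.congr' ?_
    filter_upwards [eventually_pos_mul_pow_add hp.out.one_lt hk t] with n hn
    obtain ⟨m, hm⟩ : ∃ m : ℕ, (k : ℤ) * p ^ n + t = (m + 1 : ℕ) :=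
      ⟨((k : ℤ) * p ^ n + t).toNat - 1, by omega⟩
    obtain ⟨N, hN⟩ : ∃ N, A * p ^ n = N + 1 :=
      Nat.exists_eq_succ_of_ne_zero (Nat.mul_pos hA (pow_pos hp.out.pos n)).ne'
    have h_choose := congrArg (Nat.cast : ℕ → ℤ_[p]) (Nat.add_one_mul_choose_eq N m)
    have h_index := congrArg (Int.cast : ℤ → ℤ_[p]) hm
    have h_top := congrArg (Nat.cast : ℕ → ℤ_[p]) hN
    rw [hm, hN, Int.toNat_natCast, Nat.add_sub_cancel, Nat.add_sub_cancel]
    push_cast at h_choose h_index h_top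
    linear_combination h_choose - ((N + 1).choose (m + 1) : ℤ_[p]) * h_index
      + (N.choose m : ℤ_[p]) * h_top
  have ht' : ‖(t : ℤ_[p])‖ ≠ 0 := by simpa using ht
  rw [tendsto_zero_iff_norm_tendsto_zero] at h_mul ⊢
  simpa [ht'] using h_mul.mul_const ‖(t : ℤ_[p])‖⁻¹

theorem exists_tendsto_choose_mul_pow_add (p : ℕ) [hp : Fact p.Prime] (A : ℕ) {k : ℕ} (hk : 0 < k)
    (s : ℕ) (t : ℤ) :
    ∃ L : ℤ_[p], Tendsto
      (fun n : ℕ => ((A * p ^ n + s).choose ((k : ℤ) * p ^ n + t).toNat : ℤ_[p]))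
      atTop (nhds L) := by
  induction s generalizing t with
  | zero =>
    by_cases ht : t = 0
    · subst ht
      have h_cast (n : ℕ) : ((k : ℤ) * p ^ n).toNat = k * p ^ n := by
        exact_mod_cast Int.toNat_natCast (k * p ^ n)
      simpa only [add_zero, h_cast] using exists_tendsto_choose_mul_pow p A k
    · exact ⟨0, tendsto_choose_mul_pow_add_zero p A hk ht⟩
  | succ s ih =>
    obtain ⟨L, hL⟩ := ih (t - 1)
    obtain ⟨M, hM⟩ := ih t
    refine ⟨L + M, (hL.add hM).congr' ?_⟩
    filter_upwards [eventually_pos_mul_pow_add hp.out.one_lt hk t] with n hn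
    obtain ⟨m, hm⟩ : ∃ m : ℕ, (k : ℤ) * p ^ n + t = (m + 1 : ℕ) :=
      ⟨((k : ℤ) * p ^ n + t).toNat - 1, by omega⟩
    have hm' : (k : ℤ) * p ^ n + (t - 1) = (m : ℕ) := by
      push_cast at hm
      linarith
    rw [hm, hm', Int.toNat_natCast, Int.toNat_natCast, ← add_assoc, Nat.choose_succ_succ',
      Nat.cast_add]

theorem catalan_add_choose (m : ℕ) :
    catalan m + (2 * m).choose (m + 1) = (2 * m).choose m := by
  have h_catalan := succ_mul_catalan_eq_centralBinom m
  have h_choose := Nat.choose_succ_right_eq (2 * m) m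
  rw [Nat.centralBinom_eq_two_mul_choose] at h_catalan
  rw [two_mul m, Nat.add_sub_cancel, ← two_mul] at h_choose
  refine Nat.eq_of_mul_eq_mul_left m.succ_pos ?_
  rw [Nat.succ_eq_add_one]
  linarith

/-- For every `k, r ∈ ℕ`, the sequence of Catalan numbers `n ↦ C(k·pⁿ + r)` converges
in the `p`-adic integers. -/
theorem catalan_padic_converges (p : ℕ) [Fact p.Prime] (k r : ℕ) :
    ∃ L : ℤ_[p],
      Tendsto (fun n : ℕ => (catalan (k * p ^ n + r) : ℤ_[p])) atTop (nhds L) := by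
  rcases Nat.eq_zero_or_pos k with rfl | hk
  · simpa only [zero_mul] using ⟨_, tendsto_const_nhds⟩
  obtain ⟨L, hL⟩ := exists_tendsto_choose_mul_pow_add p (2 * k) hk (2 * r) r
  obtain ⟨M, hM⟩ := exists_tendsto_choose_mul_pow_add p (2 * k) hk (2 * r) (r + 1 : ℕ)
  refine ⟨L - M, (hL.sub hM).congr fun n => ?_⟩
  have h_cast (t : ℕ) : ((k : ℤ) * p ^ n + t).toNat = k * p ^ n + t := by
    exact_mod_cast Int.toNat_natCast (k * p ^ n + t)
  rw [h_cast, h_cast, mul_assoc, ← mul_add, ← catalan_add_choose, ← add_assoc]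
  push_cast
  ring
end

section
/- Let p be a prime and θ : ℤ/pℤ → (ℤ/pℤ)^p a length-p substitution such that for every j ∈ ℤ/pℤ the word θ(j) contains each letter of ℤ/pℤ exactly once (i.e., ℓ ↦ θ(j)_ℓ is a bijection of sets of size p; the incidence matrix of θ is the all-ones matrix), and such that θ(0)_0 = 0. Define the cocycle sequence s : ℕ → ℕ by s(0) = 0 and s(p·n + ℓ) = lift(θ(s(n) mod p)_ℓ) + p·s(n) for all n ≥ 0 and 0 ≤ ℓ ≤ p−1 with p·n + ℓ > 0, where lift(j) ∈ {0, 1, …, p−1} is the canonical representative of j ∈ ℤ/pℤ. Then for every α ≥ 1, the sequence n ↦ (s(n) mod p^α) is a fixed point of the length-p substitution θ_α on ℤ/p^αℤ defined by θ_α(j)_ℓ = lift(θ(j mod p)_ℓ) + p·lift(j mod p^{α−1}) (computed in ℤ/p^αℤ, where lift(j mod p^{α−1}) ∈ {0, …, p^{α−1}−1} is the canonical representative); that is, for all n ≥ 0 and 0 ≤ ℓ < p, (s(p·n + ℓ) mod p^α) = θ_α(s(n) mod p^α)_ℓ. -/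
/-- The cocycle sequence `s` of a substitution `θ` on `ℤ/pℤ` with all-ones incidence
matrix and `θ(0)₀ = 0`, reduced modulo `p^α` for `α ≥ 1`, is a fixed point of the
length-`p` substitution `θ_α` on `ℤ/p^αℤ` given by
`θ_α(j)_ℓ = lift(θ(j mod p)_ℓ) + p·lift(j mod p^(α-1))`. -/
theorem cocycle_mod_pow_fixed_point (p : ℕ) (hp : p.Prime)
    (θ : ZMod p → Fin p → ZMod p)
    (hbij : ∀ j : ZMod p, Function.Bijective (θ j))
    (h0 : θ 0 ⟨0, hp.pos⟩ = 0)
    (s : ℕ → ℕ) (hs0 : s 0 = 0)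
    (hs : ∀ (n : ℕ) (ℓ : Fin p), 0 < p * n + ℓ →
      s (p * n + ℓ) = (θ ((s n : ZMod p)) ℓ).val + p * s n)
    (α : ℕ) (hα : 1 ≤ α) :
    ∀ (n : ℕ) (ℓ : Fin p),
      ((s (p * n + ℓ) : ZMod (p ^ α))) =
        ((θ (ZMod.castHom (dvd_pow_self p (by omega : α ≠ 0)) (ZMod p)
            ((s n : ZMod (p ^ α)))) ℓ).val : ZMod (p ^ α)) +
          (p : ZMod (p ^ α)) *
            ((ZMod.castHom (pow_dvd_pow p (by omega : α - 1 ≤ α)) (ZMod (p ^ (α - 1)))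
              ((s n : ZMod (p ^ α)))).val : ZMod (p ^ α)) := by
  intro n ℓ
  have hrec : s (p * n + ℓ) = (θ ((s n : ZMod p)) ℓ).val + p * s n := by
    rcases Nat.eq_zero_or_pos (p * n + ℓ) with h | h
    · obtain ⟨hn, hℓ⟩ := Nat.add_eq_zero_iff.mp h
      obtain rfl : n = 0 := (Nat.mul_eq_zero.mp hn).resolve_left hp.ne_zero
      obtain rfl : ℓ = ⟨0, hp.pos⟩ := Fin.ext hℓ
      simp [hs0, h0]
    · exact hs n ℓ h
  have hpow : p * p ^ (α - 1) = p ^ α := mul_pow_sub_one (by omega) p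
  rw [map_natCast, map_natCast, ZMod.val_natCast, hrec, Nat.cast_add, ← Nat.cast_mul p (_ % _),
    ← Nat.mul_mod_mul_left, hpow, ZMod.natCast_mod]
end

section
/- Let p be a prime and θ : ℤ/pℤ → (ℤ/pℤ)^p a map such that for every j ∈ ℤ/pℤ the map ℓ ↦ θ(j)_ℓ from {0,…,p−1} to ℤ/pℤ is a bijection, and θ(0)_0 = 0. Define s : ℕ → ℕ by s(0) = 0 and s(p·n + ℓ) = lift(θ(s(n) mod p)_ℓ) + p·s(n) for all n ≥ 0 and 0 ≤ ℓ ≤ p−1 with p·n + ℓ > 0, where lift(j) ∈ {0, 1, …, p−1} is the canonical representative of j ∈ ℤ/pℤ. Then s is a bijection of ℕ onto ℕ. -/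
/-- The cocycle sequence `s` of a substitution `θ` on `ℤ/pℤ` with all-ones incidence
matrix and `θ(0)₀ = 0` is a bijection of `ℕ`. -/
theorem cocycle_bijective (p : ℕ) (hp : p.Prime)
    (θ : ZMod p → Fin p → ZMod p)
    (hbij : ∀ j : ZMod p, Function.Bijective (θ j))
    (h0 : θ 0 ⟨0, hp.pos⟩ = 0)
    (s : ℕ → ℕ) (hs0 : s 0 = 0)
    (hs : ∀ (n : ℕ) (ℓ : Fin p), 0 < p * n + ℓ →
      s (p * n + ℓ) = (θ ((s n : ZMod p)) ℓ).val + p * s n) :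
    Function.Bijective s := by
  have : NeZero p := ⟨hp.ne_zero⟩
  have key (n : ℕ) (ℓ : Fin p) : s (p * n + ℓ) = (θ (s n : ZMod p) ℓ).val + p * s n := by
    rcases Nat.eq_zero_or_pos (p * n + ℓ) with h | h
    · have hn : n = 0 := (mul_eq_zero.mp (Nat.add_eq_zero_iff.mp h).1).resolve_left hp.ne_zero
      have hℓ : ℓ = ⟨0, hp.pos⟩ := Fin.ext (Nat.add_eq_zero_iff.mp h).2
      subst hn hℓ
      rw [hs0, Nat.cast_zero, h0, ZMod.val_zero]
      exact hs0
    · exact hs n ℓ h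
  have exists_digit (m : ℕ) : ∃ ℓ : Fin p, p * (m / p) + ℓ = m :=
    ⟨⟨m % p, Nat.mod_lt m hp.pos⟩, Nat.div_add_mod m p⟩
  constructor
  · have inj (N : ℕ) : ∀ m k, m + k = N → s m = s k → m = k := by
      induction N using Nat.strong_induction_on with
      | _ N ih =>
        intro m k hN h
        rcases Nat.eq_zero_or_pos N with h_zero | h_pos
        · omega
        obtain ⟨i, hi⟩ := exists_digit m
        obtain ⟨j, hj⟩ := exists_digit k
        have hlt : m / p + k / p < N := by
          have hm := Nat.div_le_self m p
          have hk := Nat.div_le_self k p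
          rcases Nat.eq_zero_or_pos m with h_m | h_m
          · have := Nat.div_lt_self (show 0 < k by omega) hp.one_lt
            omega
          · have := Nat.div_lt_self h_m hp.one_lt
            omega
        rw [← hi, ← hj, key, key] at h
        have hquot : s (m / p) = s (k / p) := by
          simpa [Nat.add_mul_div_left _ _ hp.pos, Nat.div_eq_of_lt (ZMod.val_lt _)]
            using congrArg (· / p) h
        rw [hquot, Nat.add_right_cancel_iff] at h
        have hij := (hbij _).1 (ZMod.val_injective p h)
        rw [← hi, ← hj, ih _ hlt _ _ rfl hquot, hij]
    exact fun m k h => inj _ m k rfl h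
  · intro y
    induction y using Nat.strong_induction_on with
    | _ y ih =>
      rcases Nat.eq_zero_or_pos y with rfl | hy
      · exact ⟨0, hs0⟩
      obtain ⟨n, hn⟩ := ih (y / p) (Nat.div_lt_self hy hp.one_lt)
      obtain ⟨ℓ, hℓ⟩ := (hbij (s n : ZMod p)).2 (y : ZMod p)
      exact ⟨p * n + ℓ, by rw [key, hℓ, hn, ZMod.val_natCast, Nat.mod_add_div]⟩
end

section
/- Define s : ℕ → ℕ by s(0) = 0 and, for n ≥ 0: if s(n) is even then s(2n) = 2·s(n) and s(2n+1) = 2·s(n) + 1; if s(n) is odd then s(2n) = 2·s(n) + 1 and s(2n+1) = 2·s(n). Then for all n ≥ 0 the following identities hold (as equalities of integers): s(4n) = 3·s(2n) − 2·s(n); s(4n+1) = 2·s(2n) + s(2n+1) − 2·s(n); s(4n+2) = 3·s(2n+1) − 2·s(n); s(4n+3) = s(2n) + 2·s(2n+1) − 2·s(n). (Hence s is a 2-regular sequence.) -/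
/-- The Thue–Morse cocycle sequence satisfies the stated 2-regular recurrences
(as equalities of integers). -/
theorem thueMorse_cocycle_two_regular (s : ℕ → ℕ) (hs0 : s 0 = 0)
    (hs : ∀ n : ℕ,
      (Even (s n) → s (2 * n) = 2 * s n ∧ s (2 * n + 1) = 2 * s n + 1) ∧
      (¬ Even (s n) → s (2 * n) = 2 * s n + 1 ∧ s (2 * n + 1) = 2 * s n)) :
    ∀ n : ℕ,
      ((s (4 * n) : ℤ) = 3 * s (2 * n) - 2 * s n) ∧
      ((s (4 * n + 1) : ℤ) = 2 * s (2 * n) + s (2 * n + 1) - 2 * s n) ∧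
      ((s (4 * n + 2) : ℤ) = 3 * s (2 * n + 1) - 2 * s n) ∧
      ((s (4 * n + 3) : ℤ) = s (2 * n) + 2 * s (2 * n + 1) - 2 * s n) := by
  intro n
  have h := hs n
  have h_even := hs (2 * n)
  have h_odd := hs (2 * n + 1)
  rw [show 2 * (2 * n) = 4 * n by ring] at h_even
  rw [show 2 * (2 * n + 1) + 1 = 4 * n + 3 by ring,
    show 2 * (2 * n + 1) = 4 * n + 2 by ring] at h_odd
  simp only [Nat.even_iff] at h h_even h_odd
  omega
end

section
/- Define s : ℕ → ℕ by s(0) = 0 and, for n ≥ 0: if s(n) is even then s(2n) = 2·s(n) and s(2n+1) = 2·s(n) + 1; if s(n) is odd then s(2n) = 2·s(n) + 1 and s(2n+1) = 2·s(n). Then for every integer k ≥ 2, the sequence n ↦ (s(n) mod k), with values in ℤ/kℤ, is 2-automatic. -/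
/-- One step of the recursion with a binary digit `d` in place of the two cases. -/
theorem thueMorse_cocycle_step {s : ℕ → ℕ}
    (hs : ∀ n : ℕ,
      (Even (s n) → s (2 * n) = 2 * s n ∧ s (2 * n + 1) = 2 * s n + 1) ∧
      (¬ Even (s n) → s (2 * n) = 2 * s n + 1 ∧ s (2 * n + 1) = 2 * s n))
    (n : ℕ) {d : ℕ} (hd : d < 2) :
    s (2 * n + d) = 2 * s n + if Even (s n) then d else 1 - d := by
  have h := hs n
  interval_cases d <;> split_ifs with hn <;> simp [h, hn]

/-- On a residue class modulo `2 ^ e`, the sequence is `2 ^ e * s n` plus a correction that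
depends only on the parity of `s n`. -/
theorem thueMorse_cocycle_two_pow_mul_add {s : ℕ → ℕ}
    (hs : ∀ n : ℕ,
      (Even (s n) → s (2 * n) = 2 * s n ∧ s (2 * n + 1) = 2 * s n + 1) ∧
      (¬ Even (s n) → s (2 * n) = 2 * s n + 1 ∧ s (2 * n + 1) = 2 * s n))
    (e r : ℕ) (hr : r < 2 ^ e) :
    ∃ c₀ c₁ : ℕ, ∀ n, s (2 ^ e * n + r) = 2 ^ e * s n + if Even (s n) then c₀ else c₁ := by
  induction e generalizing r with
  | zero =>
    obtain rfl : r = 0 := by simpa using hr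
    exact ⟨0, 0, fun n => by simp⟩
  | succ e ih =>
    obtain ⟨c₀, c₁, h⟩ := ih (r / 2) (by rw [pow_succ] at hr; omega)
    refine ⟨2 * c₀ + if Even c₀ then r % 2 else 1 - r % 2,
      2 * c₁ + if Even (2 ^ e + c₁) then r % 2 else 1 - r % 2, fun n => ?_⟩
    have hsplit : 2 ^ (e + 1) * n + r = 2 * (2 ^ e * n + r / 2) + r % 2 := by
      rw [pow_succ', mul_assoc]
      omega
    rw [hsplit, thueMorse_cocycle_step hs _ (Nat.mod_lt r two_pos), h]
    by_cases hn : Even (s n)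
    · have hpar : Even (2 ^ e * s n + c₀) ↔ Even c₀ := by
        simp [Nat.even_add, hn]
      simp only [hn, if_true, hpar]
      ring
    · have hpar : Even (2 ^ e * s n + c₁) ↔ Even (2 ^ e + c₁) := by
        simp only [Nat.even_add, Nat.even_mul, hn, or_false]
      simp only [hn, if_false, hpar]
      ring

/-- The Thue–Morse cocycle sequence reduced modulo any `k ≥ 2` is `2`-automatic. -/
theorem thueMorse_cocycle_mod_k_automatic (s : ℕ → ℕ) (hs0 : s 0 = 0)
    (hs : ∀ n : ℕ,
      (Even (s n) → s (2 * n) = 2 * s n ∧ s (2 * n + 1) = 2 * s n + 1) ∧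
      (¬ Even (s n) → s (2 * n) = 2 * s n + 1 ∧ s (2 * n + 1) = 2 * s n)) :
    ∀ k : ℕ, 2 ≤ k → IsKAutomatic 2 (fun n => (s n : ZMod k)) := by
  intro k hk
  have : NeZero k := ⟨by omega⟩
  refine (Set.finite_range fun (p : ZMod k × ZMod k × ZMod k) (n : ℕ) =>
    p.1 * (s n : ZMod k) + if Even (s n) then p.2.1 else p.2.2).subset ?_
  rintro g ⟨e, r, hr, rfl⟩
  obtain ⟨c₀, c₁, h⟩ := thueMorse_cocycle_two_pow_mul_add hs e r hr
  refine ⟨(2 ^ e, c₀, c₁), funext fun n => ?_⟩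
  simp [h, apply_ite (Nat.cast : ℕ → ZMod k)]
end

section
/- Let p be a prime and let a : ℕ → ℤ_p be the sequence a(n) = n (natural numbers viewed as p-adic integers). Then the closure in ℤ_p^ℕ of the forward shift orbit {σ^k(a) : k ∈ ℕ} equals the set {x : ℕ → ℤ_p | there exists c ∈ ℤ_p such that x(n) = c + n for all n ≥ 0}. -/
/-- Iterating the shift `k` times translates the index by `k`. -/
theorem shift_iterate_apply {A : Type*} (k : ℕ) (x : ℕ → A) (n : ℕ) :
    shift^[k] x n = x (n + k) := by
  induction k generalizing x with
  | zero => rfl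
  | succ k ih => rw [Function.iterate_succ_apply, ih, shift, add_assoc]

/-- The shift-orbit closure in `ℤ_p^ℕ` of the sequence `a(n) = n` is exactly the set of
arithmetic sequences `n ↦ c + n` with `c ∈ ℤ_p`. -/
theorem orbitClosure_of_identity_sequence (p : ℕ) [Fact p.Prime] :
    closure {y : ℕ → ℤ_[p] | ∃ k : ℕ, y = shift^[k] fun n : ℕ => (n : ℤ_[p])} =
      {x : ℕ → ℤ_[p] | ∃ c : ℤ_[p], ∀ n : ℕ, x n = c + (n : ℤ_[p])} := by
  let f : ℤ_[p] → ℕ → ℤ_[p] := fun c n => c + (n : ℤ_[p])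
  have hf : Continuous f := by fun_prop
  have orbit_eq : {y : ℕ → ℤ_[p] | ∃ k : ℕ, y = shift^[k] fun n : ℕ => (n : ℤ_[p])} =
      f '' Set.range ((↑) : ℕ → ℤ_[p]) := by
    have h_iter (k : ℕ) : (shift^[k] fun n : ℕ => (n : ℤ_[p])) = f k := by
      ext1 n
      rw [shift_iterate_apply, Nat.cast_add, add_comm]
    ext y
    simp [h_iter, eq_comm]
  have image_eq : f '' Set.univ = {x : ℕ → ℤ_[p] | ∃ c, ∀ n : ℕ, x n = c + (n : ℤ_[p])} := by
    ext x
    simp [f, funext_iff, eq_comm]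
  rw [orbit_eq, ← image_eq, ← PadicInt.denseRange_natCast.closure_range]
  exact (image_closure_of_isCompact isClosed_closure.isCompact hf.continuousOn).symm
end

section
/- Let C(n) = (1/(n+1))·binomial(2n, n) denote the n-th Catalan number. Then for every n ≥ 0, C(n) is not congruent to 3 modulo 4. -/
open Finset in
/-- The Catalan recurrence at an odd index, with the two symmetric halves merged. -/
theorem catalan_two_mul_add_one (m : ℕ) :
    catalan (2 * m + 1) = 2 * ∑ i ∈ range m, catalan i * catalan (2 * m - i) + catalan m ^ 2 := by
  have reflect : ∑ i ∈ range m, catalan (m + 1 + i) * catalan (2 * m - (m + 1 + i)) =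
      ∑ i ∈ range m, catalan i * catalan (2 * m - i) := by
    rw [← sum_range_reflect]
    refine sum_congr rfl fun i hi => ?_
    have hi := mem_range.mp hi
    rw [show m + 1 + (m - 1 - i) = 2 * m - i by omega, show 2 * m - (2 * m - i) = i by omega,
      mul_comm]
  rw [catalan_succ', Nat.sum_antidiagonal_eq_sum_range_succ fun i j => catalan i * catalan j,
    show (2 * m).succ = m + 1 + m by omega, sum_range_add, sum_range_succ, reflect,
    show 2 * m - m = m by omega]
  ring

open Finset in
/-- The Catalan recurrence at a positive even index, with the two symmetric halves merged. -/
theorem catalan_two_mul_add_two (m : ℕ) :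
    catalan (2 * m + 2) = 2 * ∑ i ∈ range (m + 1), catalan i * catalan (2 * m + 1 - i) := by
  have reflect : ∑ i ∈ range (m + 1), catalan (m + 1 + i) * catalan (2 * m + 1 - (m + 1 + i)) =
      ∑ i ∈ range (m + 1), catalan i * catalan (2 * m + 1 - i) := by
    rw [← sum_range_reflect]
    refine sum_congr rfl fun i hi => ?_
    have hi := mem_range.mp hi
    rw [show m + 1 + (m + 1 - 1 - i) = 2 * m + 1 - i by omega,
      show 2 * m + 1 - (2 * m + 1 - i) = i by omega, mul_comm]
  rw [catalan_succ', Nat.sum_antidiagonal_eq_sum_range_succ fun i j => catalan i * catalan j,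
    show (2 * m + 1).succ = m + 1 + (m + 1) by omega, sum_range_add, reflect]
  ring

theorem odd_catalan_two_mul_add_one_iff (m : ℕ) :
    Odd (catalan (2 * m + 1)) ↔ Odd (catalan m) := by
  rw [catalan_two_mul_add_one, Nat.odd_add', iff_true_right (even_two_mul _),
    Nat.odd_pow_iff two_ne_zero]

theorem Odd.eq_zero_or_odd_catalan_half {n : ℕ} (h : Odd (catalan n)) :
    n = 0 ∨ ∃ m, n = 2 * m + 1 ∧ Odd (catalan m) := by
  obtain ⟨m, rfl | rfl⟩ := n.even_or_odd'
  · obtain _ | m := m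
    · exact .inl rfl
    · rw [mul_add_one, catalan_two_mul_add_two, Nat.odd_mul] at h
      exact absurd h.1 (by decide)
  · exact .inr ⟨m, rfl, (odd_catalan_two_mul_add_one_iff m).mp h⟩

/-- The indices of odd Catalan numbers contain no nontrivial arithmetic progression of length
three. -/
theorem eq_of_odd_catalan_of_add_eq_two_mul {i j m : ℕ} (hi : Odd (catalan i))
    (hj : Odd (catalan j)) (hm : Odd (catalan m)) (h : i + j = 2 * m) : i = j := by
  induction m using Nat.strong_induction_on generalizing i j with
  | _ m ih =>
    obtain rfl | ⟨i', rfl, hi'⟩ := hi.eq_zero_or_odd_catalan_half <;>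
      obtain rfl | ⟨j', rfl, hj'⟩ := hj.eq_zero_or_odd_catalan_half <;>
      obtain rfl | ⟨m', rfl, hm'⟩ := hm.eq_zero_or_odd_catalan_half <;>
      try omega
    have := ih m' (by omega) hi' hj' hm' (by omega)
    omega

/-- No Catalan number is congruent to 3 modulo 4. -/
theorem catalan_mod_four_ne_three : ∀ n : ℕ, catalan n % 4 ≠ 3 := by
  intro n hn
  obtain rfl | ⟨m, rfl, hm⟩ :=
    (Nat.odd_iff.mpr (by omega) : Odd (catalan n)).eq_zero_or_odd_catalan_half
  · simp at hn
  · have hS : Even (∑ i ∈ Finset.range m, catalan i * catalan (2 * m - i)) := by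
      refine Finset.even_sum _ fun i hi => ?_
      have hi := Finset.mem_range.mp hi
      by_contra hodd
      obtain ⟨h₁, h₂⟩ := Nat.odd_mul.mp (Nat.not_even_iff_odd.mp hodd)
      have := eq_of_odd_catalan_of_add_eq_two_mul h₁ h₂ hm (by omega)
      omega
    obtain ⟨s, hs⟩ := hS
    obtain ⟨c, hc⟩ := hm
    rw [catalan_two_mul_add_one, hs, hc,
      show 2 * (s + s) + (2 * c + 1) ^ 2 = 4 * (s + c ^ 2 + c) + 1 by ring] at hn
    omega
end

section
/- Let C(n) = (1/(n+1))·binomial(2n, n) denote the n-th Catalan number. Then for every n ≥ 0, C(n) is not congruent to 9 modulo 16. -/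
open Finset in
theorem Nat.centralBinom_mul_factorial (m : ℕ) :
    m.centralBinom * m.factorial = 2 ^ m * ∏ j ∈ range m, (2 * j + 1) := by
  induction m with
  | zero => simp
  | succ m ih =>
    rw [prod_range_succ, Nat.factorial_succ, ← mul_assoc, mul_comm (centralBinom _),
      Nat.succ_mul_centralBinom_succ]
    linear_combination 2 * (2 * m + 1) * ih

open Finset in
theorem Nat.centralBinom_two_mul_mul_prod (m : ℕ) :
    (2 * m).centralBinom * ∏ j ∈ range m, (2 * j + 1) =
      m.centralBinom * ∏ j ∈ range m, (2 * m + (2 * j + 1)) := by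
  have hm := Nat.centralBinom_mul_factorial m
  have h2m := Nat.centralBinom_mul_factorial (2 * m)
  have hfac : m.centralBinom * m.factorial * m.factorial = (2 * m).factorial := by
    have := Nat.choose_mul_factorial_mul_factorial (show m ≤ 2 * m by omega)
    rwa [show 2 * m - m = m by omega] at this
  have hsplit : ∏ j ∈ range (2 * m), (2 * j + 1) =
      (∏ j ∈ range m, (2 * j + 1)) * ∏ j ∈ range m, (2 * m + (2 * j + 1)) := by
    rw [two_mul m, prod_range_add]
    congr 1
    exact prod_congr rfl fun j _ => by ring
  have hP : 0 < ∏ j ∈ range m, (2 * j + 1) := prod_pos fun j _ => by omega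
  rw [← hfac, hm, hsplit] at h2m
  generalize ∏ j ∈ range m, (2 * j + 1) = P at *
  generalize ∏ j ∈ range m, (2 * m + (2 * j + 1)) = Q at *
  have hpos : 0 < 2 ^ m * P * m.factorial := by positivity
  refine Nat.eq_of_mul_eq_mul_right hpos ?_
  rw [two_mul m, pow_add] at h2m
  rw [← two_mul] at h2m
  linear_combination P * h2m - 2 ^ m * P * Q * hm

open Finset in
theorem odd_prod_two_mul_add_one (m : ℕ) : (∏ j ∈ range m, (2 * j + 1)) % 2 = 1 := by
  simp [prod_nat_mod, Nat.add_mod]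

open Finset in
theorem prod_two_mul_add_modEq (m : ℕ) :
    ∏ j ∈ range m, (2 * m + (2 * j + 1)) ≡ ∏ j ∈ range m, (2 * j + 1) [MOD 2 * m] := by
  rw [Nat.ModEq, prod_nat_mod, prod_nat_mod (f := fun j => 2 * j + 1)]
  simp

/-- Doubling `m` preserves the class of the central binomial coefficient modulo twice any power
of two dividing `2 * m`. -/
theorem Nat.centralBinom_two_mul_modEq_of_dvd {m d : ℕ} (hm : 0 < m) (hd : 2 ^ d ∣ 2 * m) :
    (2 * m).centralBinom ≡ m.centralBinom [MOD 2 ^ (d + 1)] := by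
  have key := Nat.centralBinom_two_mul_mul_prod m
  have hodd := odd_prod_two_mul_add_one m
  have hmod := (prod_two_mul_add_modEq m).of_dvd hd
  obtain ⟨c, hc⟩ := Nat.two_dvd_centralBinom_of_one_le hm
  have hcop : Nat.gcd (2 ^ (d + 1)) (∏ j ∈ Finset.range m, (2 * j + 1)) = 1 :=
    Nat.Coprime.pow_left _ (Nat.coprime_two_left.mpr (Nat.odd_iff.mpr hodd))
  refine Nat.ModEq.cancel_right_of_coprime hcop ?_
  rw [key, hc, pow_succ', mul_assoc, mul_assoc]
  exact (hmod.mul_left c).mul_left' 2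

theorem Nat.centralBinom_mod_of_mod_four_eq_two (N : ℕ) (h : N.centralBinom % 4 = 2) :
    N = 1 ∨ N = 2 ∨ N = 4 ∨ 8 ∣ N ∧ N.centralBinom % 32 = 6 := by
  induction N using Nat.strong_induction_on with
  | _ N ih =>
    obtain ⟨m, rfl | rfl⟩ := Nat.even_or_odd' N
    · rcases Nat.eq_zero_or_pos m with rfl | hm
      · simp at h
      have h4 := Nat.centralBinom_two_mul_modEq_of_dvd (d := 1) hm ⟨m, by ring⟩
      rcases ih m (by omega) (Eq.trans (Eq.symm h4) h) with rfl | rfl | rfl | ⟨⟨k, rfl⟩, hk⟩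
      · simp
      · simp
      · have : Nat.centralBinom (2 * 4) = 12870 := by decide
        simp [this]
      · have h32 := Nat.centralBinom_two_mul_modEq_of_dvd (d := 4) hm ⟨k, by ring⟩
        exact .inr (.inr (.inr ⟨⟨2 * k, by ring⟩, Eq.trans h32 hk⟩))
    · rcases Nat.eq_zero_or_pos m with rfl | hm
      · simp
      obtain ⟨c, hc⟩ := Nat.two_dvd_centralBinom_of_one_le (show 0 < 2 * m by omega)
      have hs := Nat.succ_mul_centralBinom_succ (2 * m)
      rw [hc] at hs
      have hdvd : 4 ∣ (2 * m + 1) * (2 * m + 1).centralBinom :=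
        ⟨(2 * (2 * m) + 1) * c, by rw [hs]; ring⟩
      have hcop : Nat.Coprime 4 (2 * m + 1) := by
        rw [show 4 = 2 ^ 2 by rfl]
        exact Nat.Coprime.pow_left _ (Nat.coprime_two_left.mpr ⟨m, rfl⟩)
      have := hcop.dvd_of_dvd_mul_left hdvd
      omega

theorem centralBinom_succ_eq_mul_catalan (n : ℕ) :
    (n + 1).centralBinom = 2 * ((2 * n + 1) * catalan n) := by
  have h := Nat.succ_mul_centralBinom_succ n
  rw [← succ_mul_catalan_eq_centralBinom n] at h
  refine Nat.eq_of_mul_eq_mul_left (Nat.succ_pos n) ?_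
  rw [Nat.succ_eq_add_one]
  linear_combination h

/-- No Catalan number is congruent to 9 modulo 16. -/
theorem catalan_mod_sixteen_ne_nine : ∀ n : ℕ, catalan n % 16 ≠ 9 := by
  intro n h
  have hcb := centralBinom_succ_eq_mul_catalan n
  have hodd : ((2 * n + 1) * catalan n) % 2 = 1 :=
    Nat.odd_iff.mp (Odd.mul ⟨n, rfl⟩ (Nat.odd_iff.mpr (by omega)))
  rcases Nat.centralBinom_mod_of_mod_four_eq_two (n + 1) (by omega) with hn | hn | hn | ⟨hn, h6⟩
  · obtain rfl : n = 0 := by omega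
    simp at h
  · obtain rfl : n = 1 := by omega
    simp at h
  · obtain rfl : n = 3 := by omega
    simp [catalan_three] at h
  · have hmod : ((2 * n + 1) * catalan n) % 16 = 7 := by
      rw [Nat.mul_mod, h, show (2 * n + 1) % 16 = 15 by omega]
    omega
end

section
/- Let k, l ≥ 2 be multiplicatively independent integers, i.e., k^m = l^n for natural numbers m, n implies m = n = 0. If a sequence a : ℕ → A with values in a finite set A is both k-automatic and l-automatic, then a is eventually periodic: there exist N ≥ 0 and d ≥ 1 such that a(n + d) = a(n) for all n ≥ N. (Cobham's base-dependence theorem, invoked to show that the Thue–Morse cocycle sequence reduced mod p^α is not p-automatic for primes p ≠ 2 unless eventually periodic.) -/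
/-- `SameBlocks a K u v` says that `a` agrees on the blocks of length `2 * K` starting at
`K * u` and at `K * v`. -/
def SameBlocks {A : Type*} (a : ℕ → A) (K u v : ℕ) : Prop :=
  ∀ r < 2 * K, a (K * u + r) = a (K * v + r)

/-- Some bounded initial segment meets every colour class of a finite colouring of `ℕ`. -/
theorem exists_bound_color_representative {Q : Type*} [Finite Q] (c : ℕ → Q) :
    ∃ C : ℕ, ∀ u, ∃ x < C, c x = c u := by
  choose f hf using fun q : Set.range c => q.2
  obtain ⟨B, hB⟩ := (Set.finite_range f).bddAbove
  exact ⟨B + 1, fun u => ⟨f ⟨c u, u, rfl⟩,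
    Nat.lt_succ_of_le (hB (Set.mem_range_self _)), hf _⟩⟩

/-- For an automatic sequence, a finite colouring of the block indices determines the content of
the blocks of all lengths `k ^ e`. -/
theorem IsKAutomatic.exists_finite_coloring {A : Type*} {k : ℕ} {a : ℕ → A}
    (ha : IsKAutomatic k a) :
    ∃ (S : Set (ℕ → A)) (c : ℕ → (S → A × A)), S.Finite ∧
      ∀ u v, c u = c v → ∀ e, SameBlocks a (k ^ e) u v := by
  refine ⟨_, fun u g => (g.1 u, g.1 (u + 1)), ha, fun u v huv e r hr => ?_⟩
  rcases lt_or_ge r (k ^ e) with h | h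
  · exact congrArg Prod.fst (congrFun huv ⟨_, e, r, h, rfl⟩)
  · obtain ⟨s, rfl⟩ := Nat.exists_eq_add_of_le h
    have := congrArg Prod.snd (congrFun huv ⟨_, e, s, by omega, rfl⟩)
    simpa only [mul_add, mul_one, add_assoc] using this

/-- If `a` agrees on the blocks at `x` and `y` for the two lengths `K` and `K + h`, then it has
local period `h * (y - x)` on the block of length `2 * K` at `K * y`. -/
theorem SameBlocks.local_period {A : Type*} {a : ℕ → A} {K h x d : ℕ}
    (hK : SameBlocks a K x (x + d)) (hL : SameBlocks a (K + h) x (x + d)) {r : ℕ}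
    (hr : h * x ≤ r) (hr' : r < 2 * K) :
    a (K * (x + d) + r + h * d) = a (K * (x + d) + r) := by
  rw [← hK r hr']
  have := hL (r - h * x) (by omega)
  obtain ⟨s, rfl⟩ := Nat.exists_eq_add_of_le hr
  rw [Nat.add_sub_cancel_left] at this
  convert this.symm using 2 <;> ring

/-- A local period of `a` may be iterated as long as it stays in the given window. -/
theorem local_period_mul {A : Type*} {a : ℕ → A} {b s t p : ℕ}
    (hp : ∀ r, s ≤ r → r < t → a (b + r + p) = a (b + r)) (q : ℕ) {r : ℕ}
    (hr : s ≤ r) (hr' : r + p * q ≤ t) : a (b + r + p * q) = a (b + r) := by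
  induction q with
  | zero => simp
  | succ q ih =>
    rw [mul_add, mul_one] at hr'
    rcases Nat.eq_zero_or_pos p with rfl | hpos
    · simp
    · rw [← ih (by omega)]
      have := hp (r + p * q) (by omega) (by omega)
      simpa only [mul_add, mul_one, add_assoc] using this

/-- A sequence whose blocks of the two nearly equal lengths `K` and `K + h` are determined by a
colouring is eventually periodic, provided that all colours of large numbers occur both below `C`
and in `[C, D)`. -/
theorem eventually_periodic_of_sameBlocks {A Q : Type*} {a : ℕ → A} {c : ℕ → Q} {C D K h : ℕ}
    (hC : ∀ u, ∃ x < C, c x = c u)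
    (hD : ∀ u, C ≤ u → ∃ y, C ≤ y ∧ y < D ∧ c y = c u)
    (hK : ∀ u v, c u = c v → SameBlocks a K u v)
    (hL : ∀ u v, c u = c v → SameBlocks a (K + h) u v)
    (hpos : 0 < h) (hle : h * (D + D.factorial) ≤ K) :
    ∃ N d : ℕ, 1 ≤ d ∧ ∀ n : ℕ, N ≤ n → a (n + d) = a n := by
  have hPpos : 0 < h * D.factorial := Nat.mul_pos hpos D.factorial_pos
  rw [mul_add] at hle
  have hKpos : 0 < K := by omega
  refine ⟨K * C + h * D, h * D.factorial, hPpos, fun n hn => ?_⟩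
  obtain ⟨m, rfl⟩ := Nat.exists_eq_add_of_le' (le_of_add_le_right hn)
  have hmod := Nat.mod_lt m hKpos
  have hdiv := Nat.div_add_mod m K
  have hu : C ≤ m / K := by
    rw [Nat.le_div_iff_mul_le hKpos, mul_comm]
    omega
  set u := m / K
  set r := m % K
  obtain ⟨y, hCy, hyD, hyu⟩ := hD u hu
  obtain ⟨x, hxC, hxy⟩ := hC y
  obtain ⟨d, rfl⟩ := Nat.exists_eq_add_of_le (hxC.le.trans hCy)
  obtain ⟨q, hq⟩ : d ∣ D.factorial := Nat.dvd_factorial (by omega) (by omega)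
  have hxD : h * x ≤ h * D := Nat.mul_le_mul_left h (by omega)
  have hper : a (K * (x + d) + (r + h * D) + h * d * q) = a (K * (x + d) + (r + h * D)) :=
    local_period_mul (s := h * x) (t := 2 * K)
      (fun r hr hr' => (hK _ _ hxy).local_period (hL _ _ hxy) hr hr') q (by omega)
      (by rw [mul_assoc, ← hq]; omega)
  rw [mul_assoc, ← hq, add_assoc, hK _ _ hyu _ (by omega), hK _ _ hyu _ (by omega)] at hper
  rw [← hdiv]
  simpa only [add_assoc] using hper

/-- Powers of two integers `k, l ≥ 2` come arbitrarily close to each other, relative to their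
size. -/
theorem exists_close_pow {k l : ℕ} (hk : 2 ≤ k) (hl : 2 ≤ l) {M : ℕ} (hM : 0 < M) :
    ∃ m n : ℕ, 0 < m ∧ M * l ^ n ≤ (M + 1) * k ^ m ∧ M * k ^ m ≤ (M + 1) * l ^ n := by
  have hlogl : 0 < Real.log l := Real.log_pos (by exact_mod_cast hl)
  have hlogk : 0 < Real.log k := Real.log_pos (by exact_mod_cast hk)
  have hk0 : (0 : ℝ) < k := by positivity
  have hl0 : (0 : ℝ) < l := by positivity
  have hM0 : (0 : ℝ) < M := by positivity
  set δ : ℝ := Real.log ((M + 1) / M)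
  have hδ : 0 < δ := Real.log_pos (by rw [one_lt_div hM0]; linarith)
  obtain ⟨N, hN⟩ := exists_nat_gt (Real.log l / δ)
  have hNpos : 0 < N := by
    have := (div_pos hlogl hδ).trans hN
    exact_mod_cast this
  obtain ⟨j, m, hm, -, hmj⟩ :=
    Real.exists_int_int_abs_mul_sub_le (Real.log k / Real.log l) hNpos
  have hj : 0 ≤ j := by
    have h1 : (1 : ℝ) / (N + 1) < 1 := by
      rw [div_lt_one (by positivity)]
      have : (0 : ℝ) < N := by exact_mod_cast hNpos
      linarith
    have h2 : 0 < (m : ℝ) * (Real.log k / Real.log l) := by positivity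
    have h3 : (-1 : ℝ) < j := by linarith [(abs_le.mp hmj).2]
    have h4 : (-1 : ℤ) < j := by exact_mod_cast h3
    omega
  lift j to ℕ using hj
  lift m to ℕ using hm.le
  have hclose : |m * Real.log k - j * Real.log l| ≤ δ := by
    have hfac : m * Real.log k - j * Real.log l =
        (m * (Real.log k / Real.log l) - j) * Real.log l := by field_simp
    rw [hfac, abs_mul, abs_of_pos hlogl]
    push_cast at hmj
    calc _ ≤ 1 / ((N : ℝ) + 1) * Real.log l := by gcongr
      _ ≤ δ := by
        rw [div_lt_iff₀ hδ] at hN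
        rw [one_div_mul_eq_div, div_le_iff₀ (by positivity)]
        linarith
  have key : ∀ {x y : ℝ}, 0 < x → 0 < y → Real.log x - Real.log y ≤ δ →
      M * x ≤ (M + 1) * y := by
    intro x y hx hy hxy
    rw [← Real.log_div hx.ne' hy.ne', Real.log_le_log_iff (by positivity) (by positivity),
      div_le_div_iff₀ hy hM0] at hxy
    linarith
  rw [← Real.log_pow, ← Real.log_pow, abs_le] at hclose
  refine ⟨m, j, by exact_mod_cast hm, ?_, ?_⟩
  · exact_mod_cast key (pow_pos hl0 j) (pow_pos hk0 m) (by linarith [hclose.1])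
  · exact_mod_cast key (pow_pos hk0 m) (pow_pos hl0 j) hclose.2

/-- Cobham's base-dependence theorem: a sequence that is both `k`-automatic and
`l`-automatic for multiplicatively independent `k, l ≥ 2` is eventually periodic. -/
theorem cobham_base_dependence {A : Type*} [Finite A] (k l : ℕ)
    (hk : 2 ≤ k) (hl : 2 ≤ l)
    (hindep : ∀ m n : ℕ, k ^ m = l ^ n → m = 0 ∧ n = 0)
    (a : ℕ → A) (hka : IsKAutomatic k a) (hla : IsKAutomatic l a) :
    ∃ N d : ℕ, 1 ≤ d ∧ ∀ n : ℕ, N ≤ n → a (n + d) = a n := by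
  obtain ⟨S, c, hS, hc⟩ := hka.exists_finite_coloring
  obtain ⟨T, c', hT, hc'⟩ := hla.exists_finite_coloring
  have := hS.to_subtype
  have := hT.to_subtype
  let col := fun u => (c u, c' u)
  have hcol : ∀ u v, col u = col v → ∀ e, SameBlocks a (k ^ e) u v :=
    fun u v h => hc u v (congrArg Prod.fst h)
  have hcol' : ∀ u v, col u = col v → ∀ e, SameBlocks a (l ^ e) u v :=
    fun u v h => hc' u v (congrArg Prod.snd h)
  obtain ⟨C, hC⟩ := exists_bound_color_representative col
  obtain ⟨B, hB⟩ := exists_bound_color_representative fun u => col (C + u)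
  have hD : ∀ u, C ≤ u → ∃ y, C ≤ y ∧ y < C + B ∧ col y = col u := by
    intro u hu
    obtain ⟨v, rfl⟩ := Nat.exists_eq_add_of_le hu
    obtain ⟨y, hy, hyv⟩ := hB v
    exact ⟨C + y, by omega, by omega, hyv⟩
  have hMpos : 0 < C + B + (C + B).factorial := by
    have := (C + B).factorial_pos
    omega
  obtain ⟨m, n, hm, h₁, h₂⟩ := exists_close_pow hk hl hMpos
  have hne : k ^ m ≠ l ^ n := fun h => hm.ne' (hindep m n h).1
  rcases hne.lt_or_gt with hlt | hlt
  · obtain ⟨h, hh⟩ := Nat.exists_eq_add_of_le hlt.le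
    refine eventually_periodic_of_sameBlocks (K := k ^ m) (h := h) hC hD
      (fun u v huv => hcol u v huv m) (fun u v huv => hh ▸ hcol' u v huv n) (by omega) ?_
    rw [hh] at h₁
    linarith
  · obtain ⟨h, hh⟩ := Nat.exists_eq_add_of_le hlt.le
    refine eventually_periodic_of_sameBlocks (K := l ^ n) (h := h) hC hD
      (fun u v huv => hcol' u v huv n) (fun u v huv => hh ▸ hcol u v huv m) (by omega) ?_
    rw [hh] at h₂
    linarith
end
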